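/- There is an algorithm (a computable function) which, given a finite alphabet encoded as Fin m, a morphism φ encoded as a function Fin m → List (Fin m), and a letter a on which φ is prolongable, decides whether the pure morphic sequence φ^∞(a) is ultimately periodic. -/

import Mathlib

open Filter Asymptotics

variable {A : Type*}

/-- Extension of a morphism, given on letters, to words. -/
def wordMap (φ : A → List A) (w : List A) : List A := w.flatMap φ

/-- The factor of the infinite word α of length n starting at position i. -/
def factorAt (α : ℕ → A) (i n : ℕ) : List A := (List.range n).map (fun j => α (i + j))

/-- w is a factor (contiguous subword) of the infinite word α. -/
def IsFactor (α : ℕ → A) (w : List A) : Prop := ∃ i, w = factorAt α i w.length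

/-- The factor complexity of α: the number of distinct factors of length n. -/
noncomputable def complexity (α : ℕ → A) (n : ℕ) : ℕ :=
  Set.ncard {w : List A | w.length = n ∧ IsFactor α w}

def UltimatelyPeriodic (α : ℕ → A) : Prop :=
  ∃ N p : ℕ, 1 ≤ p ∧ ∀ i, N ≤ i → α (i + p) = α i

/-- φ is prolongable on a: φ(a) = a·w with w nonempty and |φ^n(a)| → ∞. -/
def Prolongable (φ : A → List A) (a : A) : Prop :=
  (∃ w, w ≠ [] ∧ φ a = a :: w) ∧
    Tendsto (fun n => ((wordMap φ)^[n] [a]).length) atTop atTop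

/-- α is the pure morphic sequence φ^∞(a): every iterate φ^n(a) is a prefix of α. -/
def IsFixedSeq (φ : A → List A) (a : A) (α : ℕ → A) : Prop :=
  ∀ n, factorAt α 0 ((wordMap φ)^[n] [a]).length = (wordMap φ)^[n] [a]

/-- The letter b is growing for φ: |φ^k(b)| → ∞. -/
def GrowingLetter (φ : A → List A) (b : A) : Prop :=
  Tendsto (fun k => ((wordMap φ)^[k] [b]).length) atTop atTop

def BoundedLetter (φ : A → List A) (b : A) : Prop := ¬ GrowingLetter φ b

/-- φ is growing: every letter is growing. -/
def Growing (φ : A → List A) : Prop := ∀ b, GrowingLetter φ b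

/-- Encoding of a morphism on Fin m as a list of lists of naturals. -/
def encodeMorphism {m : ℕ} (φ : Fin m → List (Fin m)) : List (List ℕ) :=
  (List.finRange m).map (fun i => (φ i).map Fin.val)

variable {B : Type*}

/-- The finite word w occurs in the infinite word x at position i. -/
def OccursAt (w : List A) (x : ℕ → A) (i : ℕ) : Prop := factorAt x i w.length = w

@[simp] lemma length_factorAt (x : ℕ → A) (i n : ℕ) : (factorAt x i n).length = n := by
  simp [factorAt]

@[simp] lemma factorAt_zero (x : ℕ → A) (i : ℕ) : factorAt x i 0 = [] := by
  simp [factorAt]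

lemma factorAt_one (x : ℕ → A) (i : ℕ) : factorAt x i 1 = [x i] := by
  simp [factorAt]

lemma getElem_factorAt (x : ℕ → A) (i n t : ℕ) (ht : t < (factorAt x i n).length) :
    (factorAt x i n)[t] = x (i + t) := by
  simp [factorAt]

lemma factorAt_add (x : ℕ → A) (i m n : ℕ) :
    factorAt x i (m + n) = factorAt x i m ++ factorAt x (i + m) n := by
  simp [factorAt, List.range_add, Function.comp_def, add_assoc]

lemma factorAt_succ' (x : ℕ → A) (i n : ℕ) :
    factorAt x i (n + 1) = x i :: factorAt x (i + 1) n := by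
  rw [add_comm, factorAt_add, factorAt_one]; rfl

lemma factorAt_prefix (x : ℕ → A) (i : ℕ) {m n : ℕ} (h : m ≤ n) :
    factorAt x i m <+: factorAt x i n := by
  obtain ⟨k, rfl⟩ := Nat.exists_eq_add_of_le h
  rw [factorAt_add]; exact List.prefix_append _ _

lemma factorAt_congr {x y : ℕ → A} {i j n : ℕ} (h : ∀ t < n, x (i + t) = y (j + t)) :
    factorAt x i n = factorAt y j n := by
  simp only [factorAt]
  exact List.map_congr_left fun t ht => h t (List.mem_range.1 ht)

lemma factorAt_inj {x y : ℕ → A} {i j n : ℕ} (h : factorAt x i n = factorAt y j n) {t : ℕ}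
    (ht : t < n) : x (i + t) = y (j + t) := by
  have h1 := getElem_factorAt x i n t (by simpa using ht)
  have h2 := getElem_factorAt y j n t (by simpa using ht)
  rw [← h1, ← h2]; simp only [h]

lemma mem_factorAt {x : ℕ → A} {i n : ℕ} {c : A} (h : c ∈ factorAt x i n) :
    ∃ t < n, c = x (i + t) := by
  simp only [factorAt, List.mem_map, List.mem_range] at h
  obtain ⟨t, ht, rfl⟩ := h
  exact ⟨t, ht, rfl⟩

lemma factorAt_comp {C : Type*} (f : A → C) (x : ℕ → A) (i n : ℕ) :
    factorAt (f ∘ x) i n = (factorAt x i n).map f := by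
  simp [factorAt]

lemma occursAt_factorAt (x : ℕ → A) (i n : ℕ) : OccursAt (factorAt x i n) x i := by
  simp [OccursAt]

lemma occursAt_append {u v : List A} {x : ℕ → A} {i : ℕ} :
    OccursAt (u ++ v) x i ↔ OccursAt u x i ∧ OccursAt v x (i + u.length) := by
  unfold OccursAt
  rw [List.length_append, factorAt_add]
  constructor
  · intro h
    exact List.append_inj h (by simp)
  · rintro ⟨h1, h2⟩
    rw [h1, h2]

lemma OccursAt.of_prefix {u w : List A} {x : ℕ → A} {i : ℕ} (h : OccursAt w x i)
    (hu : u <+: w) : OccursAt u x i := by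
  obtain ⟨v, rfl⟩ := hu
  exact (occursAt_append.1 h).1

lemma OccursAt.getElem {w : List A} {x : ℕ → A} {i t : ℕ} (h : OccursAt w x i)
    (ht : t < w.length) : w[t] = x (i + t) := by
  have := getElem_factorAt x i w.length t (by simpa using ht)
  rw [← this]
  unfold OccursAt at h
  simp only [h]

lemma occursAt_singleton {x : ℕ → A} {i : ℕ} {c : A} : OccursAt [c] x i ↔ x i = c := by
  simp [OccursAt, factorAt_one]

lemma OccursAt.prefix_of_le {u w : List A} {x : ℕ → A} {i : ℕ} (hu : OccursAt u x i)
    (hw : OccursAt w x i) (h : u.length ≤ w.length) : u <+: w := by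
  rw [← hu, ← hw]
  exact factorAt_prefix x i h

/-- Two words are comparable if one of them is a prefix of the other. -/
def Comparable (u v : List A) : Prop := u <+: v ∨ v <+: u

lemma Comparable.symm {u v : List A} (h : Comparable u v) : Comparable v u := Or.symm h

lemma comparable_iff_take {u v : List A} :
    Comparable u v ↔ u.take v.length = v.take u.length := by
  constructor
  · rintro (h | h)
    · rw [List.take_of_length_le h.length_le]
      exact List.prefix_iff_eq_take.1 h
    · rw [List.take_of_length_le (l := v) h.length_le]
      exact (List.prefix_iff_eq_take.1 h).symm
  · intro h
    rcases le_total u.length v.length with hl | hl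
    · rw [List.take_of_length_le hl] at h
      exact Or.inl (List.prefix_iff_eq_take.2 h)
    · rw [List.take_of_length_le hl] at h
      exact Or.inr (List.prefix_iff_eq_take.2 h.symm)

lemma comparable_of_prefix {u v w : List A} (hu : u <+: w) (hv : v <+: w) : Comparable u v :=
  List.prefix_or_prefix_of_prefix hu hv

lemma Comparable.of_prefix {u v u' v' : List A} (h : Comparable u v) (hu : u' <+: u)
    (hv : v' <+: v) : Comparable u' v' := by
  rcases h with h | h
  · exact comparable_of_prefix (hu.trans h) hv
  · exact comparable_of_prefix hu (hv.trans h)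

lemma comparable_append_left {w u v : List A} :
    Comparable (w ++ u) (w ++ v) ↔ Comparable u v := by
  simp [Comparable, List.prefix_append_right_inj]

lemma OccursAt.comparable {u v : List A} {x : ℕ → A} {i : ℕ} (hu : OccursAt u x i)
    (hv : OccursAt v x i) : Comparable u v := by
  rcases le_total u.length v.length with h | h
  · exact Or.inl (hu.prefix_of_le hv h)
  · exact Or.inr (hv.prefix_of_le hu h)

lemma flatMap_prefix {u v : List A} (h : A → List B) (huv : u <+: v) :
    u.flatMap h <+: v.flatMap h := by
  obtain ⟨w, rfl⟩ := huv
  rw [List.flatMap_append]; exact List.prefix_append _ _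

lemma exists_limit (w : ℕ → List A) (hw : ∀ m n, m ≤ n → w m <+: w n)
    (hl : ∀ K, ∃ n, K ≤ (w n).length) : ∃ x : ℕ → A, ∀ n, OccursAt (w n) x 0 := by
  choose N hN using hl
  refine ⟨fun i => (w (N (i + 1)))[i]'(hN (i + 1)), fun n => ?_⟩
  refine List.ext_getElem (by simp) fun t h1 h2 => ?_
  rw [getElem_factorAt]
  simp only [zero_add]
  rcases le_total n (N (t + 1)) with h | h
  · exact ((hw _ _ h).getElem h2).symm
  · exact (hw _ _ h).getElem (hN (t + 1))

/-- The infinite word y is the image of the infinite word x under the morphism h. -/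
def IsImage (h : A → List B) (x : ℕ → A) (y : ℕ → B) : Prop :=
  ∀ n, OccursAt ((factorAt x 0 n).flatMap h) y 0

/-- The length of the image of the prefix of length n of x. -/
def imageLength (h : A → List B) (x : ℕ → A) (n : ℕ) : ℕ :=
  ((factorAt x 0 n).flatMap h).length

lemma imageLength_add (h : A → List B) (x : ℕ → A) (i n : ℕ) :
    imageLength h x (i + n) = imageLength h x i + ((factorAt x i n).flatMap h).length := by
  simp [imageLength, factorAt_add]

lemma imageLength_add_length {h : A → List B} {x : ℕ → A} {w : List A} {i : ℕ}
    (hw : OccursAt w x i) :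
    imageLength h x (i + w.length) = imageLength h x i + (w.flatMap h).length := by
  rw [imageLength_add, hw]

lemma imageLength_mono (h : A → List B) (x : ℕ → A) : Monotone (imageLength h x) := by
  intro m n hmn
  obtain ⟨k, rfl⟩ := Nat.exists_eq_add_of_le hmn
  rw [imageLength_add]; omega

lemma IsImage.occursAt {h : A → List B} {x : ℕ → A} {y : ℕ → B} (hI : IsImage h x y)
    {w : List A} {i : ℕ} (hw : OccursAt w x i) : OccursAt (w.flatMap h) y (imageLength h x i) := by
  have := hI (i + w.length)
  rw [factorAt_add, List.flatMap_append, occursAt_append, zero_add, hw, zero_add] at this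
  exact this.2

lemma IsImage.exists_prefix {h : A → List B} {x : ℕ → A} {y : ℕ → B}
    (hI : IsImage h x y) (hl : ∀ K, ∃ n, K ≤ imageLength h x n) (n : ℕ) :
    ∃ k, factorAt y 0 n <+: (factorAt x 0 k).flatMap h := by
  obtain ⟨k, hk⟩ := hl n
  exact ⟨k, (occursAt_factorAt y 0 n).prefix_of_le (hI k) (by rw [length_factorAt]; exact hk)⟩

lemma UltimatelyPeriodic.of_tails {y : ℕ → A} {X Y : ℕ} (hXY : X < Y)
    (h : ∀ t, y (X + t) = y (Y + t)) : UltimatelyPeriodic y := by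
  refine ⟨X, Y - X, by omega, fun i hi => ?_⟩
  have := h (i - X)
  rw [show X + (i - X) = i by omega, show Y + (i - X) = i + (Y - X) by omega] at this
  exact this.symm

/-- The image of an ultimately periodic word: an explicit pair of equal tails. -/
lemma IsImage.tails_eq {h : A → List B} {x : ℕ → A} {y : ℕ → B} (hI : IsImage h x y)
    (hl : ∀ K, ∃ n, K ≤ imageLength h x n) {N p : ℕ} (hx : ∀ i, N ≤ i → x (i + p) = x i) (t : ℕ) :
    y (imageLength h x N + t) = y (imageLength h x (N + p) + t) := by
  obtain ⟨n, hn⟩ := hl (imageLength h x N + t + 1)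
  have hle : N ≤ n := by
    by_contra hlt
    have := imageLength_mono h x (le_of_not_ge hlt)
    omega
  obtain ⟨k, rfl⟩ := Nat.exists_eq_add_of_le hle
  have e : factorAt x N k = factorAt x (N + p) k := factorAt_congr fun t _ => by
    rw [← hx (N + t) (by omega)]; congr 1; omega
  have h1 := hI.occursAt (occursAt_factorAt x N k)
  have h2 := hI.occursAt (occursAt_factorAt x (N + p) k)
  rw [← e] at h2
  rw [imageLength_add] at hn
  rw [← h1.getElem (t := t) (by omega), ← h2.getElem (t := t) (by omega)]

lemma imageLength_lt {h : A → List B} {x : ℕ → A}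
    (hl : ∀ K, ∃ n, K ≤ imageLength h x n) {N p : ℕ} (hp : 1 ≤ p)
    (hx : ∀ i, N ≤ i → x (i + p) = x i) : imageLength h x N < imageLength h x (N + p) := by
  by_contra hlt
  have hz : (factorAt x N p).flatMap h = [] := by
    rw [imageLength_add] at hlt
    exact List.length_eq_zero_iff.1 (by omega)
  have hper : ∀ k, factorAt x (N + p * k) p = factorAt x N p := by
    intro k
    induction k with
    | zero => simp
    | succ k ih =>
      rw [← ih]
      refine factorAt_congr fun t _ => ?_
      rw [← hx (N + p * k + t) (by omega)]; congr 1; ring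
  have hc : ∀ k, imageLength h x (N + p * k) = imageLength h x N := by
    intro k
    induction k with
    | zero => simp
    | succ k ih =>
      rw [mul_add, mul_one, ← add_assoc, imageLength_add, hper, hz, ih]; simp
  obtain ⟨n, hn⟩ := hl (imageLength h x N + 1)
  have := imageLength_mono h x (show n ≤ N + p * n by nlinarith)
  rw [hc] at this
  omega

lemma UltimatelyPeriodic.image {h : A → List B} {x : ℕ → A} {y : ℕ → B} (hI : IsImage h x y)
    (hl : ∀ K, ∃ n, K ≤ imageLength h x n) (hx : UltimatelyPeriodic x) :
    UltimatelyPeriodic y := by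
  obtain ⟨N, p, hp, hx⟩ := hx
  exact .of_tails (imageLength_lt hl hp hx) (hI.tails_eq hl hx)

lemma iterate_wordMap_nil (φ : A → List A) (n : ℕ) : (wordMap φ)^[n] [] = [] := by
  induction n with
  | zero => rfl
  | succ n ih => rw [Function.iterate_succ_apply]; exact ih

lemma iterate_wordMap_append (ψ : A → List A) (n : ℕ) (u v : List A) :
    (wordMap ψ)^[n] (u ++ v) = (wordMap ψ)^[n] u ++ (wordMap ψ)^[n] v := by
  induction n generalizing u v with
  | zero => rfl
  | succ n ih =>
    simp only [Function.iterate_succ_apply, wordMap, List.flatMap_append] at ih ⊢; rw [ih]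

lemma IsImage.iterate {ψ : A → List A} {x : ℕ → A} (hI : IsImage ψ x x) {w : List A} {i : ℕ}
    (hw : OccursAt w x i) (r : ℕ) :
    OccursAt ((wordMap ψ)^[r] w) x ((imageLength ψ x)^[r] i) ∧
      (imageLength ψ x)^[r] (i + w.length) =
        (imageLength ψ x)^[r] i + ((wordMap ψ)^[r] w).length := by
  induction r with
  | zero => exact ⟨hw, rfl⟩
  | succ r ih =>
    simp only [Function.iterate_succ_apply']
    refine ⟨hI.occursAt ih.1, ?_⟩
    rw [ih.2, imageLength_add_length ih.1]; rfl

section FixedPoint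

variable {φ : A → List A} {a : A} {α : ℕ → A}

lemma Prolongable.exists_length_ge (h : Prolongable φ a) (K N : ℕ) :
    ∃ n, N ≤ n ∧ K ≤ ((wordMap φ)^[n] [a]).length :=
  ((eventually_ge_atTop N).and (h.2.eventually_ge_atTop K)).exists

lemma IsFixedSeq.occursAt (h : IsFixedSeq φ a α) (n : ℕ) :
    OccursAt ((wordMap φ)^[n] [a]) α 0 := h n

lemma IsFixedSeq.isImage (hp : Prolongable φ a) (h : IsFixedSeq φ a α) : IsImage φ α α := by
  intro n
  obtain ⟨k, -, hk⟩ := hp.exists_length_ge n 0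
  have := (occursAt_factorAt α 0 n).prefix_of_le (h.occursAt k) (by simpa using hk)
  refine (h.occursAt (k + 1)).of_prefix ?_
  rw [Function.iterate_succ_apply']
  exact flatMap_prefix φ this

lemma IsFixedSeq.imageLength_length (h : IsFixedSeq φ a α) (n : ℕ) :
    imageLength φ α ((wordMap φ)^[n] [a]).length = ((wordMap φ)^[n + 1] [a]).length := by
  rw [imageLength, h n, Function.iterate_succ_apply']; rfl

lemma IsFixedSeq.exists_imageLength_ge (hp : Prolongable φ a) (h : IsFixedSeq φ a α) (K : ℕ) :
    ∃ n, K ≤ imageLength φ α n := by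
  obtain ⟨k, hk, hl⟩ := hp.exists_length_ge K 1
  obtain ⟨k, rfl⟩ := Nat.exists_eq_add_of_le' hk
  exact ⟨_, hl.trans (h.imageLength_length k).ge⟩

lemma iterate_succ_of_head {w : List A} (hw : φ a = a :: w) (n : ℕ) :
    (wordMap φ)^[n + 1] [a] = (wordMap φ)^[n] [a] ++ (wordMap φ)^[n] w := by
  rw [Function.iterate_succ_apply, ← iterate_wordMap_append]
  simp [wordMap, hw]

/-- The i-th power of a word. -/
def wordPow (v : List A) (i : ℕ) : List A := (List.range i).flatMap fun _ => v

lemma wordPow_zero (v : List A) : wordPow v 0 = [] := rfl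

lemma wordPow_succ (v : List A) (i : ℕ) : wordPow v (i + 1) = wordPow v i ++ v := by
  simp [wordPow, List.range_succ, List.flatMap_append]

lemma wordPow_add (v : List A) (i j : ℕ) : wordPow v (i + j) = wordPow v i ++ wordPow v j := by
  induction j with
  | zero => simp [wordPow_zero]
  | succ j ih => rw [← add_assoc, wordPow_succ, ih, wordPow_succ, List.append_assoc]

lemma wordPow_wordPow (v : List A) (i j : ℕ) : wordPow (wordPow v i) j = wordPow v (i * j) := by
  induction j with
  | zero => simp [wordPow_zero]
  | succ j ih => rw [wordPow_succ, ih, mul_add, mul_one, wordPow_add]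

lemma length_wordPow (v : List A) (i : ℕ) : (wordPow v i).length = i * v.length := by
  simp [wordPow]

lemma flatMap_wordPow (h : A → List B) (v : List A) (i : ℕ) :
    (wordPow v i).flatMap h = wordPow (v.flatMap h) i := by
  induction i with
  | zero => simp [wordPow_zero]
  | succ i ih => rw [wordPow_succ, List.flatMap_append, ih, wordPow_succ]

lemma append_wordPow (u v : List A) (i : ℕ) :
    u ++ wordPow (v ++ u) i = wordPow (u ++ v) i ++ u := by
  induction i with
  | zero => simp [wordPow_zero]
  | succ i ih => rw [wordPow_succ, ← List.append_assoc, ih, wordPow_succ]; simp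

lemma getElem?_wordPow (v : List A) (i t : ℕ) (ht : t + v.length < i * v.length) :
    (wordPow v i)[t + v.length]? = (wordPow v i)[t]? := by
  obtain _ | i := i
  · simp at ht
  have h1 : wordPow v (i + 1) = v ++ wordPow v i := by
    rw [add_comm, wordPow_add, wordPow_succ, wordPow_zero]; simp
  have h2 : t < (wordPow v i).length := by rw [length_wordPow]; rw [add_mul] at ht; omega
  conv_lhs => rw [h1, List.getElem?_append_right (by omega)]
  rw [wordPow_succ, List.getElem?_append_left h2]; simp

/-- A finite certificate that the fixed point of φ starting with a is u (v₁ v₂) (v₁ v₂) ⋯. -/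
def PeriodicityWitness (φ : A → List A) (a : A) (u v₁ v₂ : List A) (i j : ℕ) : Prop :=
  u.head? = some a ∧ v₁ ++ v₂ ≠ [] ∧ u.flatMap φ = u ++ wordPow (v₁ ++ v₂) i ++ v₁ ∧
    (v₁ ++ v₂).flatMap φ = wordPow (v₂ ++ v₁) j

lemma PeriodicityWitness.ultimatelyPeriodic {u v₁ v₂ : List A} {i j : ℕ}
    (h : PeriodicityWitness φ a u v₁ v₂ i j) (hp : Prolongable φ a) (hα : IsFixedSeq φ a α) :
    UltimatelyPeriodic α := by
  obtain ⟨hu, hv, hφu, hφv⟩ := h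
  have key : ∀ n, ∃ q, (wordMap φ)^[n] [a] <+: u ++ wordPow (v₁ ++ v₂) q := by
    intro n
    induction n with
    | zero =>
      refine ⟨0, ?_⟩
      cases u with
      | nil => simp at hu
      | cons c u => simp at hu; simp [hu]
    | succ n ih =>
      obtain ⟨q, hq⟩ := ih
      refine ⟨i + j * q + 1, ?_⟩
      rw [Function.iterate_succ_apply']
      refine (flatMap_prefix φ hq).trans ?_
      rw [List.flatMap_append, flatMap_wordPow, hφu, hφv, wordPow_wordPow, List.append_assoc,
        append_wordPow, wordPow_succ, wordPow_add]
      simp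
  refine ⟨u.length, (v₁ ++ v₂).length, List.length_pos_of_ne_nil hv, fun t ht => ?_⟩
  obtain ⟨t, rfl⟩ := Nat.exists_eq_add_of_le ht
  obtain ⟨n, -, hn⟩ := hp.exists_length_ge (u.length + t + (v₁ ++ v₂).length + 1) 0
  obtain ⟨q, hq⟩ := key n
  have get : ∀ s, (hs : s < ((wordMap φ)^[n] [a]).length) →
      (u ++ wordPow (v₁ ++ v₂) q)[s]? = some (α s) := by
    intro s hs
    rw [← List.prefix_iff_getElem?.1 hq s hs |>.symm, (hα.occursAt n).getElem hs, zero_add]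
  have h1 := get (u.length + t + (v₁ ++ v₂).length) (by omega)
  have h2 := get (u.length + t) (by omega)
  rw [List.getElem?_append_right (by omega)] at h1 h2
  have e1 : u.length + t + (v₁ ++ v₂).length - u.length = t + (v₁ ++ v₂).length := by omega
  rw [e1, getElem?_wordPow] at h1
  · rw [Nat.add_sub_cancel_left] at h2
    exact Option.some.inj (h1.symm.trans h2)
  · have := hq.length_le
    rw [List.length_append, length_wordPow] at this
    omega

lemma exists_minimal_period {x : ℕ → A} (hx : UltimatelyPeriodic x) :
    ∃ N p, 1 ≤ p ∧ (∀ i, N ≤ i → x (i + p) = x i) ∧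
      ∀ M r, (∀ i, M ≤ i → x (i + r) = x i) → p ∣ r := by
  classical
  have hex : ∃ p, 1 ≤ p ∧ ∃ N, ∀ i, N ≤ i → x (i + p) = x i := by
    obtain ⟨N, p, hp, h⟩ := hx
    exact ⟨p, hp, N, h⟩
  obtain ⟨hp, N, hN⟩ := Nat.find_spec hex
  refine ⟨N, Nat.find hex, hp, hN, fun M r hr => ?_⟩
  set p := Nat.find hex with hpdef
  by_contra hnd
  have hpos : 1 ≤ r % p := Nat.pos_of_ne_zero fun h => hnd (Nat.dvd_of_mod_eq_zero h)
  refine Nat.find_min hex (Nat.mod_lt r hp) ⟨hpos, max M N, fun i hi => ?_⟩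
  have hmul : ∀ k i, N ≤ i → x (i + p * k) = x i := by
    intro k
    induction k with
    | zero => simp
    | succ k ih =>
      intro i hi
      rw [mul_add, mul_one, ← add_assoc, hN _ (by omega), ih i hi]
  rw [← hmul (r / p) (i + r % p) (by omega), add_assoc, Nat.mod_add_div, hr i (by omega)]

lemma factorAt_mul_of_periodic {x : ℕ → A} {N p : ℕ} (hx : ∀ i, N ≤ i → x (i + p) = x i)
    {X : ℕ} (hX : N ≤ X) (k : ℕ) :
    factorAt x X (p * k) = wordPow (factorAt x X p) k ∧
      ∀ t n, factorAt x (X + p * k + t) n = factorAt x (X + t) n := by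
  induction k with
  | zero => simp [wordPow_zero]
  | succ k ih =>
    have e : ∀ t n, factorAt x (X + p * (k + 1) + t) n = factorAt x (X + t) n := by
      intro t n
      rw [← ih.2]
      refine factorAt_congr fun s _ => ?_
      rw [← hx (X + p * k + t + s) (by omega)]; congr 1; ring
    refine ⟨?_, e⟩
    have := ih.2 0 p
    simp only [add_zero] at this
    rw [mul_add, mul_one, factorAt_add, ih.1, this, wordPow_succ]

lemma UltimatelyPeriodic.exists_witness (hp : Prolongable φ a) (hα : IsFixedSeq φ a α)
    (h : UltimatelyPeriodic α) : ∃ u v₁ v₂ i j, PeriodicityWitness φ a u v₁ v₂ i j := by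
  obtain ⟨N₀, p, hp1, hN₀, hmin⟩ := exists_minimal_period h
  obtain ⟨n, -, hn⟩ := hp.exists_length_ge N₀ 0
  obtain ⟨w, -, hw⟩ := hp.1
  set u := (wordMap φ)^[n] [a] with hu
  set N := u.length with hNdef
  have hN : ∀ i, N ≤ i → α (i + p) = α i := fun i hi => hN₀ i (by omega)
  set z := (wordMap φ)^[n] w with hz
  have hI := hα.isImage hp
  have hunb := hα.exists_imageLength_ge hp
  have huz : u.flatMap φ = u ++ z := by
    rw [hu, hz, ← iterate_succ_of_head hw, Function.iterate_succ_apply']; rfl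
  have hzocc : OccursAt z α N := by
    have := hα.occursAt (n + 1)
    rw [iterate_succ_of_head hw, occursAt_append, zero_add] at this
    exact this.2
  have hsN : imageLength φ α N = N + z.length := by
    rw [hNdef, hu, hα.imageLength_length, iterate_succ_of_head hw, List.length_append]
  have hdvd : p ∣ ((factorAt α N p).flatMap φ).length := by
    refine hmin (imageLength φ α N) _ fun i hi => ?_
    have := hI.tails_eq hunb hN (i - imageLength φ α N)
    rw [imageLength_add] at this
    rw [show imageLength φ α N + (i - imageLength φ α N) = i by omega] at this
    rw [this]; congr 1; omega
  obtain ⟨j, hj⟩ := hdvd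
  set ρ := z.length % p with hρ
  have hρp : ρ < p := Nat.mod_lt _ hp1
  set i := z.length / p
  have hdm : p * i + ρ = z.length := Nat.div_add_mod _ _
  have hv : factorAt α N ρ ++ factorAt α (N + ρ) (p - ρ) = factorAt α N p := by
    rw [← factorAt_add]; congr 1; omega
  refine ⟨u, factorAt α N ρ, factorAt α (N + ρ) (p - ρ), i, j, ?_, ?_, ?_, ?_⟩
  · have hlen : 0 < u.length := by
      have : ∀ k, 0 < ((wordMap φ)^[k] [a]).length := by
        intro k
        induction k with
        | zero => simp
        | succ k ih => rw [iterate_succ_of_head hw, List.length_append]; omega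
      exact this n
    have h0 := hα.occursAt 0
    rw [List.head?_eq_getElem?, List.getElem?_eq_getElem hlen, (hα.occursAt n).getElem hlen]
    rw [Function.iterate_zero_apply, occursAt_singleton] at h0
    simp [h0]
  · rw [hv]
    intro h0
    have := congrArg List.length h0
    simp at this
    omega
  · rw [hv, huz, List.append_assoc, ← (factorAt_mul_of_periodic hN le_rfl i).1]
    congr 1
    have := (factorAt_mul_of_periodic hN le_rfl i).2 0 ρ
    simp only [add_zero] at this
    rw [← this, ← factorAt_add, hdm, hzocc]
  · rw [hv, ← hI.occursAt (occursAt_factorAt α N p), hj, hsN,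
      (factorAt_mul_of_periodic hN (Nat.le_add_right _ _) j).1]
    congr 1
    rw [← hdm, ← add_assoc, (factorAt_mul_of_periodic hN le_rfl i).2]
    have := (factorAt_mul_of_periodic hN le_rfl 1).2 0 ρ
    simp only [add_zero, mul_one] at this
    rw [← this, show N + p = N + ρ + (p - ρ) by omega, ← factorAt_add]
    congr 1
    omega

end FixedPoint

section Nonperiodic

variable {ψ : B → List B} {β : ℕ → B}

lemma length_le_flatMap {h : A → List B} (hne : ∀ c, h c ≠ []) (w : List A) :
    w.length ≤ (w.flatMap h).length := by
  induction w with
  | nil => simp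
  | cons c w ih =>
    have := List.length_pos_of_ne_nil (hne c)
    simp only [List.flatMap_cons, List.length_append, List.length_cons]
    omega

lemma length_le_iterate (hne : ∀ c, ψ c ≠ []) (n : ℕ) (w : List B) :
    w.length ≤ ((wordMap ψ)^[n] w).length := by
  induction n with
  | zero => exact le_rfl
  | succ n ih =>
    rw [Function.iterate_succ_apply']
    exact ih.trans (length_le_flatMap hne _)

/-- The letter b reproduces itself together with at least one other letter. -/
def SelfReproducing (ψ : B → List B) (b : B) (t : ℕ) : Prop :=
  b ∈ (wordMap ψ)^[t] [b] ∧ 2 ≤ ((wordMap ψ)^[t] [b]).length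

lemma SelfReproducing.lt_length (hne : ∀ c, ψ c ≠ []) {b : B} {t : ℕ}
    (h : SelfReproducing ψ b t) (e : ℕ) : e < ((wordMap ψ)^[t * e] [b]).length := by
  obtain ⟨hb, hl⟩ := h
  obtain ⟨x, y, hxy⟩ := List.append_of_mem hb
  rw [hxy, List.length_append, List.length_cons] at hl
  induction e with
  | zero => simp
  | succ e ih =>
    rw [mul_add, mul_one, Function.iterate_add_apply, hxy, ← List.singleton_append,
      iterate_wordMap_append, iterate_wordMap_append, List.length_append, List.length_append]
    have h1 := length_le_iterate hne (t * e) x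
    have h2 := length_le_iterate hne (t * e) y
    omega

/-- Distinct letters of S are separated by their images after d further letters of S. -/
def HasDelay (ψ : B → List B) (S : Set B) (d : ℕ) : Prop :=
  ∀ U V : List B, U.length = d + 1 → V.length = d + 1 → (∀ c ∈ U, c ∈ S) → (∀ c ∈ V, c ∈ S) →
    U.head? ≠ V.head? → ¬ Comparable (U.flatMap ψ) (V.flatMap ψ)

lemma HasDelay.tails_ne {S : Set B} {d : ℕ} (hd : HasDelay ψ S d) (hS : ∀ n, β n ∈ S)
    (hI : IsImage ψ β β) {X Y : ℕ} (hXY : ∃ q, β (X + q) ≠ β (Y + q)) :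
    ∃ q, β (imageLength ψ β X + q) ≠ β (imageLength ψ β Y + q) := by
  classical
  by_contra! hcon
  set q := Nat.find hXY with hq
  have hne : β (X + q) ≠ β (Y + q) := Nat.find_spec hXY
  have hc : factorAt β X q = factorAt β Y q :=
    factorAt_congr fun t ht => not_not.1 (Nat.find_min hXY ht)
  have hX := hI.occursAt (occursAt_factorAt β (X + q) (d + 1))
  have hY := hI.occursAt (occursAt_factorAt β (Y + q) (d + 1))
  rw [imageLength_add, hc] at hX
  rw [imageLength_add] at hY
  refine hd (factorAt β (X + q) (d + 1)) (factorAt β (Y + q) (d + 1)) (by simp) (by simp)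
    ?_ ?_ ?_ (OccursAt.comparable (hX) ?_)
  · intro c h
    obtain ⟨t, -, rfl⟩ := mem_factorAt h
    exact hS _
  · intro c h
    obtain ⟨t, -, rfl⟩ := mem_factorAt h
    exact hS _
  · simpa [factorAt_succ'] using hne
  · unfold OccursAt at hY ⊢
    rw [← hY, length_factorAt]
    refine factorAt_congr fun t _ => ?_
    rw [add_assoc, add_assoc, hcon]

theorem not_ultimatelyPeriodic_of_tails_ne {S : Set B} {d : ℕ} (hd : HasDelay ψ S d)
    (hS : ∀ n, β n ∈ S) (hI : IsImage ψ β β) (hne : ∀ c, ψ c ≠ []) {b : B} {t : ℕ}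
    (hb : SelfReproducing ψ b t) {k i j q : ℕ} (hki : k < i) (hij : i < j) (hbk : β k = b)
    (hbi : β i = b) (hbj : β j = b) (hq : β (i + q) ≠ β (j + q)) : ¬ UltimatelyPeriodic β := by
  rintro ⟨N, p, hp, hN⟩
  set s := imageLength ψ β with hs
  have hmono : Monotone s := imageLength_mono ψ β
  have hdiff : ∀ r, ∃ q, β (s^[r] i + q) ≠ β (s^[r] j + q) := by
    intro r
    induction r with
    | zero => exact ⟨q, hq⟩
    | succ r ih =>
      simp only [Function.iterate_succ_apply']
      exact hd.tails_ne hS hI ih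
  have hlen := hb.lt_length hne (N + p)
  set r := t * (N + p) with hr
  have hk := hI.iterate (occursAt_singleton.2 hbk) r
  have hi := (hI.iterate (occursAt_singleton.2 hbi) r).1
  have hj := (hI.iterate (occursAt_singleton.2 hbj) r).1
  have hiN : N ≤ s^[r] i := by
    have h1 : s^[r] (k + 1) ≤ s^[r] i := hmono.iterate r hki
    have h2 := hk.2
    rw [List.length_singleton, ← hs] at h2
    omega
  have hjN : N ≤ s^[r] j := hiN.trans (hmono.iterate r hij.le)
  have hmod : ∀ X, N ≤ X → ∀ q, β (X + q) = β (X + q % p) := by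
    intro X hX q
    have h := (factorAt_mul_of_periodic hN hX (q / p)).2 (q % p) 1
    rw [factorAt_one, factorAt_one, add_assoc, Nat.div_add_mod] at h
    simpa using h
  obtain ⟨q, hq⟩ := hdiff r
  apply hq
  have hqp := Nat.mod_lt q hp
  rw [hmod _ hiN, hmod _ hjN, ← hi.getElem (t := q % p) (by omega),
    ← hj.getElem (t := q % p) (by omega)]

/-- The letters that occur in some iterate of b. -/
def Reach (ψ : B → List B) (b : B) : Set B := {c | ∃ n, c ∈ (wordMap ψ)^[n] [b]}

lemma mem_iterate_of_mem {w : List B} {b c : B} {n : ℕ} (hb : b ∈ w)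
    (hc : c ∈ (wordMap ψ)^[n] [b]) : c ∈ (wordMap ψ)^[n] w := by
  obtain ⟨x, y, rfl⟩ := List.append_of_mem hb
  rw [← List.singleton_append, iterate_wordMap_append, iterate_wordMap_append]
  simp [hc]

lemma Reach.trans {b c : B} (h : c ∈ Reach ψ b) : Reach ψ c ⊆ Reach ψ b := by
  rintro e ⟨n, hn⟩
  obtain ⟨m, hm⟩ := h
  refine ⟨n + m, ?_⟩
  rw [Function.iterate_add_apply]
  exact mem_iterate_of_mem hm hn

lemma exists_bound_word {w : List B}
    (h : ∀ b ∈ w, ∃ C, ∀ n, ((wordMap ψ)^[n] [b]).length ≤ C) :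
    ∃ C, ∀ n, ((wordMap ψ)^[n] w).length ≤ C := by
  induction w with
  | nil => exact ⟨0, fun n => by rw [iterate_wordMap_nil]; simp⟩
  | cons b w ih =>
    obtain ⟨C₁, h₁⟩ := ih fun c hc => h c (List.mem_cons_of_mem _ hc)
    obtain ⟨C₂, h₂⟩ := h b List.mem_cons_self
    refine ⟨C₂ + C₁, fun n => ?_⟩
    rw [← List.singleton_append, iterate_wordMap_append, List.length_append]
    exact add_le_add (h₂ n) (h₁ n)

lemma exists_bound_letter [Finite B] (hne : ∀ c, ψ c ≠ []) (b : B)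
    (hb : ∀ c ∈ Reach ψ b, ∀ t, ¬ SelfReproducing ψ c t) :
    ∃ C, ∀ n, ((wordMap ψ)^[n] [b]).length ≤ C := by
  classical
  induction hcard : (Reach ψ b).ncard using Nat.strong_induction_on generalizing b with
  | _ k ih =>
    by_cases hone : ∀ n, ((wordMap ψ)^[n] [b]).length ≤ 1
    · exact ⟨1, hone⟩
    push Not at hone
    have hn := Nat.find_spec hone
    have hmin := fun m => Nat.find_min hone (m := m)
    rcases hN : Nat.find hone with _ | n
    · rw [hN] at hn; simp at hn
    rw [hN] at hn
    have h1 : ((wordMap ψ)^[n] [b]).length = 1 := by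
      have := hmin n (by omega)
      have := length_le_iterate hne n [b]
      simp only [List.length_singleton] at this
      omega
    obtain ⟨c, hc⟩ := List.length_eq_one_iff.1 h1
    rw [Function.iterate_succ_apply', hc] at hn
    have hcb : c ∈ Reach ψ b := ⟨n, by simp [hc]⟩
    obtain ⟨C, hC⟩ : ∃ C, ∀ n, ((wordMap ψ)^[n] (wordMap ψ [c])).length ≤ C := by
      refine exists_bound_word fun e he => ?_
      have hec : e ∈ Reach ψ c := ⟨1, he⟩
      have hsub : Reach ψ e ⊆ Reach ψ b := (Reach.trans hec).trans (Reach.trans hcb)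
      have hnot : c ∉ Reach ψ e := by
        rintro ⟨m, hm⟩
        have hmem : c ∈ (wordMap ψ)^[m] (wordMap ψ [c]) := mem_iterate_of_mem he hm
        refine hb c hcb (m + 1) ⟨hmem, ?_⟩
        rw [Function.iterate_succ_apply]
        have := length_le_iterate hne m (wordMap ψ [c])
        omega
      refine ih _ ?_ e (fun x hx => hb x (hsub hx)) rfl
      rw [← hcard]
      exact Set.ncard_lt_ncard ⟨hsub, fun h => hnot (h hcb)⟩ (Set.toFinite _)
    refine ⟨C, fun m => ?_⟩
    have e : (wordMap ψ)^[m + (n + 1)] [b] = (wordMap ψ)^[m] (wordMap ψ [c]) := by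
      rw [Function.iterate_add_apply, Function.iterate_succ_apply', hc]
    have h2 := length_le_iterate hne (n + 1) ((wordMap ψ)^[m] [b])
    rw [← Function.iterate_add_apply, add_comm, e] at h2
    exact h2.trans (hC m)

lemma le_imageLength (hne : ∀ c, ψ c ≠ []) (n : ℕ) : n ≤ imageLength ψ β n := by
  have := length_le_flatMap hne (factorAt β 0 n)
  rwa [length_factorAt] at this

lemma ultimatelyPeriodic_of_bounded [Finite B] (hne : ∀ c, ψ c ≠ []) (hI : IsImage ψ β β)
    (hgrow : ∃ q, imageLength ψ β q ≠ q) {N : ℕ}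
    (hN : ∀ i, N ≤ i → ∀ t, ¬ SelfReproducing ψ (β i) t) : UltimatelyPeriodic β := by
  set s := imageLength ψ β with hs
  obtain ⟨q, hq⟩ := hgrow
  have hle : ∀ n r, n ≤ s^[r] n := by
    intro n r
    induction r with
    | zero => exact le_rfl
    | succ r ih =>
      rw [Function.iterate_succ_apply']
      exact ih.trans (le_imageLength hne _)
  set M := q + N with hM
  have hsM : M < s M := by
    have h1 : q ≤ s q := le_imageLength hne q
    have h2 : s M = s q + ((factorAt β q N).flatMap ψ).length := imageLength_add ψ β q N
    have h3 := length_le_flatMap hne (factorAt β q N)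
    rw [length_factorAt] at h3
    omega
  set z := factorAt β M (s M - M) with hz
  have hzl : z.length = s M - M := by simp [hz]
  have hocc : ∀ n, OccursAt ((wordMap ψ)^[n] z) β (s^[n] M) ∧
      s^[n + 1] M = s^[n] M + ((wordMap ψ)^[n] z).length := by
    intro n
    have := hI.iterate (occursAt_factorAt β M (s M - M)) n
    rw [length_factorAt, show M + (s M - M) = s M by omega] at this
    exact this
  obtain ⟨C, hC⟩ : ∃ C, ∀ n, ((wordMap ψ)^[n] z).length ≤ C := by
    refine exists_bound_word fun b hb => exists_bound_letter hne b fun c hc t => ?_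
    obtain ⟨i, -, rfl⟩ := mem_factorAt hb
    obtain ⟨n, hn⟩ := hc
    obtain ⟨e, he, rfl⟩ := List.mem_iff_getElem.1 hn
    rw [((hI.iterate (occursAt_singleton.2 rfl) n).1).getElem he]
    refine hN _ ?_ t
    have := hle (M + i) n
    rw [← hs]
    omega
  obtain ⟨n₁, n₂, hlt, heq⟩ : ∃ n₁ n₂, n₁ < n₂ ∧ (wordMap ψ)^[n₁] z = (wordMap ψ)^[n₂] z := by
    have hfin : {w : List B | w.length ≤ C}.Finite := List.finite_length_le B C
    obtain ⟨n₁, -, n₂, -, hne', heq⟩ := Set.infinite_univ.exists_ne_map_eq_of_mapsTo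
      (f := fun n => (wordMap ψ)^[n] z) (fun n _ => hC n) hfin
    rcases lt_or_gt_of_ne hne' with h | h
    · exact ⟨n₁, n₂, h, heq⟩
    · exact ⟨n₂, n₁, h, heq.symm⟩
  have hzne : ∀ n, 0 < ((wordMap ψ)^[n] z).length := fun n =>
    lt_of_lt_of_le (by omega) (length_le_iterate hne n z)
  have hit : ∀ k, (wordMap ψ)^[n₁ + k] z = (wordMap ψ)^[n₂ + k] z := by
    intro k
    rw [add_comm, add_comm n₂, Function.iterate_add_apply, heq, ← Function.iterate_add_apply]
  have hfac : ∀ k, ∃ L, k ≤ L ∧ s^[n₁ + k] M = s^[n₁] M + L ∧ s^[n₂ + k] M = s^[n₂] M + L ∧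
      factorAt β (s^[n₁] M) L = factorAt β (s^[n₂] M) L := by
    intro k
    induction k with
    | zero => exact ⟨0, le_rfl, rfl, rfl, by simp⟩
    | succ k ih =>
      obtain ⟨L, hkL, h1, h2, h3⟩ := ih
      obtain ⟨o1, e1⟩ := hocc (n₁ + k)
      obtain ⟨o2, e2⟩ := hocc (n₂ + k)
      have hpos := hzne (n₁ + k)
      refine ⟨L + ((wordMap ψ)^[n₁ + k] z).length, by omega, ?_, ?_, ?_⟩
      · rw [← add_assoc, e1, h1, add_assoc]
      · rw [← add_assoc, e2, h2, ← hit, add_assoc]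
      · rw [factorAt_add, factorAt_add, h3, ← h1, ← h2, o1, hit, o2]
  have hXY : s^[n₁] M < s^[n₂] M := by
    have hstrict : StrictMono fun n => s^[n] M := strictMono_nat_of_lt_succ fun n => by
      have := (hocc n).2
      have := hzne n
      show s^[n] M < s^[n + 1] M
      omega
    exact hstrict hlt
  refine .of_tails hXY fun t => ?_
  obtain ⟨L, hL, -, -, h⟩ := hfac (t + 1)
  exact factorAt_inj h (by omega)

theorem exists_tails_ne_of_not_ultimatelyPeriodic [Finite B] (hne : ∀ c, ψ c ≠ [])
    (hI : IsImage ψ β β) (hgrow : ∃ q, imageLength ψ β q ≠ q) (hβ : ¬ UltimatelyPeriodic β) :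
    ∃ b t k i j q, SelfReproducing ψ b t ∧ k < i ∧ i < j ∧ β k = b ∧ β i = b ∧ β j = b ∧
      β (i + q) ≠ β (j + q) := by
  obtain ⟨b, ⟨t, hb⟩, hinf⟩ : ∃ b, (∃ t, SelfReproducing ψ b t) ∧ ∀ N, ∃ i, N ≤ i ∧ β i = b := by
    by_contra! hcon
    apply hβ
    choose! F hF using hcon
    obtain ⟨N, hN⟩ := (Set.finite_range F).bddAbove
    refine ultimatelyPeriodic_of_bounded hne hI hgrow (N := N) fun i hi t hsr => ?_
    exact hF (β i) ⟨t, hsr⟩ i ((hN ⟨_, rfl⟩).trans hi) rfl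
  obtain ⟨k, -, hk⟩ := hinf 0
  obtain ⟨i, hki, hi⟩ := hinf (k + 1)
  obtain ⟨j, hij, hj⟩ := hinf (i + 1)
  obtain ⟨q, hq⟩ : ∃ q, β (i + q) ≠ β (j + q) := by
    by_contra! h
    exact hβ (.of_tails hij h)
  exact ⟨b, t, k, i, j, q, hb, hki, hij, hk, hi, hj, hq⟩

end Nonperiodic

section Factorization

variable {D C : Type}

/-- The morphism ψ factors through a smaller alphabet. -/
def Simplifiable (ψ : D → List C) : Prop :=
  ∃ (E : Type) (_ : Finite E), Nat.card E < Nat.card D ∧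
    ∃ (h : D → List E) (g : E → List C), ∀ c, ψ c = (h c).flatMap g

lemma simplifiable_of_subtype [Finite D] {ψ : D → List C} (y : D)
    (h : D → List {c : D // c ≠ y}) (hh : ∀ c, ψ c = (h c).flatMap fun e => ψ e.1) :
    Simplifiable ψ := by
  refine ⟨{c : D // c ≠ y}, inferInstance, ?_, h, fun e => ψ e.1, hh⟩
  exact Finite.card_subtype_lt (x := y) (by simp)

lemma simplifiable_of_eq_nil [Finite D] {ψ : D → List C} {y : D} (hy : ψ y = []) :
    Simplifiable ψ := by
  classical
  refine simplifiable_of_subtype y (fun c => if hc : c = y then [] else [⟨c, hc⟩]) fun c => ?_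
  by_cases hc : c = y
  · simp [hc, hy]
  · simp [hc]

lemma simplifiable_of_eq [Finite D] {ψ : D → List C} {x y : D} (hxy : x ≠ y) (h : ψ x = ψ y) :
    Simplifiable ψ := by
  classical
  refine simplifiable_of_subtype y
    (fun c => if hc : c = y then [⟨x, hxy⟩] else [⟨c, hc⟩]) fun c => ?_
  by_cases hc : c = y
  · simp [hc, h]
  · simp [hc]

theorem simplifiable_or_delay [Finite D] (ψ : D → List C) :
    Simplifiable ψ ∨ (∀ c, ψ c ≠ []) ∧ ∃ d, ∀ p q u v, p ≠ q → d ≤ u.length → d ≤ v.length →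
      ¬ Comparable ((p :: u).flatMap ψ) ((q :: v).flatMap ψ) := by
  classical
  have := Fintype.ofFinite D
  induction hn : ∑ c, (ψ c).length using Nat.strong_induction_on generalizing ψ with
  | _ n ih =>
  by_cases hne : ∀ c, ψ c ≠ []
  swap
  · push Not at hne
    exact Or.inl (simplifiable_of_eq_nil hne.choose_spec)
  by_cases hcmp : ∃ x y, x ≠ y ∧ ψ x <+: ψ y
  swap
  · refine Or.inr ⟨hne, 0, fun p q u v hpq _ _ h => hcmp ?_⟩
    simp only [List.flatMap_cons] at h
    rcases h.of_prefix (List.prefix_append _ _) (List.prefix_append _ _) with h | h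
    · exact ⟨p, q, hpq, h⟩
    · exact ⟨q, p, hpq.symm, h⟩
  obtain ⟨x, y, hxy, z, hz⟩ := hcmp
  by_cases hz0 : z = []
  · rw [hz0, List.append_nil] at hz
    exact Or.inl (simplifiable_of_eq hxy hz)
  set τ : D → List D := Function.update (fun c => [c]) y [x, y] with hτ
  set ψ' : D → List C := Function.update ψ y z with hψ'
  have hτy : τ y = [x, y] := by simp [hτ]
  have hτc : ∀ c, c ≠ y → τ c = [c] := fun c hc => by simp [hτ, hc]
  have hψ'y : ψ' y = z := by simp [hψ']
  have hψ'c : ∀ c, c ≠ y → ψ' c = ψ c := fun c hc => by simp [hψ', hc]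
  have hfac : ∀ c, ψ c = (τ c).flatMap ψ' := by
    intro c
    by_cases hc : c = y
    · subst hc
      simp [hτy, hψ'y, hψ'c x hxy, hz]
    · simp [hτc c hc, hψ'c c hc]
  have hfacw : ∀ w : List D, w.flatMap ψ = (w.flatMap τ).flatMap ψ' := by
    intro w
    rw [List.flatMap_assoc]
    exact congrArg (fun f => w.flatMap f) (funext hfac)
  have hlt : ∑ c, (ψ' c).length < n := by
    rw [← hn]
    refine Finset.sum_lt_sum (fun c _ => ?_) ⟨y, Finset.mem_univ y, ?_⟩
    · by_cases hc : c = y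
      · subst hc
        rw [hψ'y, ← hz]; simp
      · rw [hψ'c c hc]
    · have := List.length_pos_of_ne_nil (hne x)
      rw [hψ'y, ← hz, List.length_append]; omega
  rcases ih _ hlt ψ' rfl with ⟨E, hE, hcard, h, g, hg⟩ | ⟨-, d, hd⟩
  · refine Or.inl ⟨E, hE, hcard, fun c => (τ c).flatMap h, g, fun c => ?_⟩
    rw [hfac, List.flatMap_assoc]
    exact congrArg (fun f => (τ c).flatMap f) (funext hg)
  have hτne : ∀ c, τ c ≠ [] := by
    intro c
    by_cases hc : c = y
    · rw [hc, hτy]; simp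
    · rw [hτc c hc]; simp
  have hτhead : ∀ c, ∃ r, τ c = (if c = y then x else c) :: r := by
    intro c
    by_cases hc : c = y
    · exact ⟨[y], by simp [hc, hτy]⟩
    · exact ⟨[], by simp [hc, hτc c hc]⟩
  have hspecial : ∀ u v, d + 1 ≤ u.length → d + 1 ≤ v.length →
      ¬ Comparable ((x :: u).flatMap ψ) ((y :: v).flatMap ψ) := by
    intro u v hu hv h
    rw [hfacw, hfacw] at h
    simp only [List.flatMap_cons, hτy, hτc x hxy, List.cons_append, List.nil_append] at h
    rw [comparable_append_left] at h
    obtain _ | ⟨c, u⟩ := u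
    · simp at hu
    obtain ⟨r, hr⟩ := hτhead c
    simp only [List.length_cons] at hu
    have hlu := length_le_flatMap hτne u
    have hlv := length_le_flatMap hτne v
    refine hd (if c = y then x else c) y (r ++ u.flatMap τ) (v.flatMap τ) ?_ ?_ ?_ ?_
    · split_ifs with hc
      · exact hxy
      · exact hc
    · rw [List.length_append]; omega
    · omega
    · simpa [hr] using h
  refine Or.inr ⟨hne, d + 1, fun p q u v hpq hu hv h => ?_⟩
  by_cases hhead : (if p = y then x else p) = (if q = y then x else q)
  · by_cases hp : p = y
    · have hq : q ≠ y := fun hq => hpq (hp.trans hq.symm)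
      rw [if_pos hp, if_neg hq] at hhead
      subst hp hhead
      exact hspecial v u hv hu h.symm
    · by_cases hq : q = y
      · rw [if_neg hp, if_pos hq] at hhead
        subst hq hhead
        exact hspecial u v hu hv h
      · rw [if_neg hp, if_neg hq] at hhead
        exact hpq hhead
  · obtain ⟨r, hr⟩ := hτhead p
    obtain ⟨r', hr'⟩ := hτhead q
    have hlu := length_le_flatMap hτne u
    have hlv := length_le_flatMap hτne v
    refine hd _ _ (r ++ u.flatMap τ) (r' ++ v.flatMap τ) hhead ?_ ?_ ?_
    · rw [List.length_append]; omega
    · rw [List.length_append]; omega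
    · rw [hfacw, hfacw] at h
      simpa [hr, hr'] using h

lemma flatMap_iterate_wordMap (φ : A → List A) (l : ℕ) (w : List A) :
    (w.flatMap fun x => (wordMap φ)^[l] [x]) = (wordMap φ)^[l] w := by
  induction w with
  | nil => simp [iterate_wordMap_nil]
  | cons c w ih => rw [List.flatMap_cons, ih, ← iterate_wordMap_append]; rfl

/-- Every morphism on a finite alphabet is dominated by one that is not simplifiable. -/
theorem exists_reduction [Finite D] (φ : D → List D) :
    ∃ (k : ℕ) (h : D → List (Fin k)) (g : Fin k → List D) (ψ : Fin k → List (Fin k)) (l : ℕ),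
      (∀ c, (φ c).flatMap h = (h c).flatMap ψ) ∧ (∀ c, (h c).flatMap g = (wordMap φ)^[l] [c]) ∧
      ¬ Simplifiable ψ := by
  classical
  let P : ℕ → Prop := fun k => ∃ (h : D → List (Fin k)) (g : Fin k → List D)
    (ψ : Fin k → List (Fin k)) (l : ℕ),
      (∀ c, (φ c).flatMap h = (h c).flatMap ψ) ∧ (∀ c, (h c).flatMap g = (wordMap φ)^[l] [c])
  have transfer : ∀ (E : Type) [Finite E] (h : D → List E) (g : E → List D) (ψ : E → List E)
      (l : ℕ), (∀ c, (φ c).flatMap h = (h c).flatMap ψ) →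
      (∀ c, (h c).flatMap g = (wordMap φ)^[l] [c]) → P (Nat.card E) := by
    intro E _ h g ψ l h1 h2
    let e := Finite.equivFin E
    refine ⟨fun c => (h c).map e, fun i => g (e.symm i), fun i => (ψ (e.symm i)).map e, l,
      fun c => ?_, fun c => ?_⟩
    · have := congrArg (List.map e) (h1 c)
      simpa [List.map_flatMap, List.flatMap_map] using this
    · simpa [List.flatMap_map] using h2 c
  have hex : ∃ k, P k := ⟨_, transfer D (fun c => [c]) (fun c => [c]) φ 0 (by simp) (by simp)⟩
  obtain ⟨h, g, ψ, l, h1, h2⟩ := Nat.find_spec hex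
  refine ⟨Nat.find hex, h, g, ψ, l, h1, h2, ?_⟩
  rintro ⟨E, hE, hcard, h', g', hg⟩
  rw [Nat.card_fin] at hcard
  refine Nat.find_min hex hcard (transfer E (fun c => (h c).flatMap h')
    (fun e => (g' e).flatMap g) (fun e => (g' e).flatMap h') (l + 1) (fun c => ?_) fun c => ?_)
  · rw [← List.flatMap_assoc, h1, ← List.flatMap_assoc,
      show ψ = fun c => (h' c).flatMap g' from funext hg]
    simp only [List.flatMap_assoc]
  · rw [← List.flatMap_assoc, List.flatMap_assoc (l := h c),
      ← show ψ = fun c => (h' c).flatMap g' from funext hg, ← h1, List.flatMap_assoc,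
      show (fun x => (h x).flatMap g) = fun x => (wordMap φ)^[l] [x] from funext h2]
    rw [flatMap_iterate_wordMap, Function.iterate_succ_apply]
    simp [wordMap]

end Factorization

section Reduction

variable {φ : A → List A} {a : A} {α : ℕ → A} {h : A → List B} {ψ : B → List B}

lemma flatMap_comm_of_mem {w : List A}
    (comm : ∀ c ∈ w, (φ c).flatMap h = (h c).flatMap ψ) :
    (w.flatMap φ).flatMap h = (w.flatMap h).flatMap ψ := by
  rw [List.flatMap_assoc, List.flatMap_assoc]
  exact List.flatMap_congr comm

lemma IsFixedSeq.flatMap_iterate (hα : IsFixedSeq φ a α)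
    (comm : ∀ n, (φ (α n)).flatMap h = (h (α n)).flatMap ψ) (n r : ℕ) :
    ((wordMap φ)^[n + r] [a]).flatMap h = (wordMap ψ)^[r] (((wordMap φ)^[n] [a]).flatMap h) := by
  induction r with
  | zero => rfl
  | succ r ih =>
    rw [← add_assoc, Function.iterate_succ_apply', Function.iterate_succ_apply', ← ih]
    refine flatMap_comm_of_mem fun c hc => ?_
    rw [← hα (n + r)] at hc
    obtain ⟨t, -, rfl⟩ := mem_factorAt hc
    exact comm _

lemma exists_image_fixed (hI : IsImage φ α α)
    (comm : ∀ n, (φ (α n)).flatMap h = (h (α n)).flatMap ψ)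
    (hl : ∀ K, ∃ n, K ≤ imageLength h α n) : ∃ β, IsImage h α β ∧ IsImage ψ β β := by
  obtain ⟨β, hβ⟩ := exists_limit (fun n => (factorAt α 0 n).flatMap h)
    (fun m n hmn => flatMap_prefix h (factorAt_prefix α 0 hmn)) hl
  refine ⟨β, hβ, fun n => ?_⟩
  obtain ⟨k, hk⟩ := IsImage.exists_prefix hβ hl n
  have := flatMap_prefix ψ hk
  rw [← flatMap_comm_of_mem (φ := φ)] at this
  · refine OccursAt.of_prefix ?_ this
    rw [← hI k]
    exact hβ _
  · intro c hc
    obtain ⟨t, -, rfl⟩ := mem_factorAt hc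
    exact comm _

lemma IsFixedSeq.imageLength_length' (hα : IsFixedSeq φ a α) (n : ℕ) :
    imageLength h α ((wordMap φ)^[n] [a]).length = (((wordMap φ)^[n] [a]).flatMap h).length := by
  rw [imageLength, hα n]

theorem not_ultimatelyPeriodic_of_image (hp : Prolongable φ a) (hα : IsFixedSeq φ a α)
    (comm : ∀ n, (φ (α n)).flatMap h = (h (α n)).flatMap ψ) (hne : ∀ c, ψ c ≠ []) {S : Set B}
    {d : ℕ} (hd : HasDelay ψ S d) (hS : ∀ n, ∀ c ∈ h (α n), c ∈ S) {b : B} {t : ℕ}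
    (hb : SelfReproducing ψ b t) {n k i j q : ℕ} (hki : k < i) (hij : i < j) {W : List B}
    (hW : W = ((wordMap φ)^[n] [a]).flatMap h) (hbk : W[k]? = some b) (hbi : W[i]? = some b)
    (hbj : W[j]? = some b) (hiq : i + q < W.length) (hjq : j + q < W.length)
    (hq : W[i + q]? ≠ W[j + q]?) : ¬ UltimatelyPeriodic α := by
  have hI := hα.isImage hp
  have hl : ∀ K, ∃ n, K ≤ imageLength h α n := by
    intro K
    refine ⟨((wordMap φ)^[n + t * K] [a]).length, ?_⟩
    rw [hα.imageLength_length', hα.flatMap_iterate comm, ← hW]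
    obtain ⟨x, y, hxy⟩ := List.append_of_mem (List.mem_of_getElem? hbk)
    rw [hxy, ← List.singleton_append, iterate_wordMap_append, iterate_wordMap_append,
      List.length_append, List.length_append]
    have := hb.lt_length hne K
    omega
  obtain ⟨β, hβ, hβ'⟩ := exists_image_fixed hI comm hl
  have hβS : ∀ n, β n ∈ S := by
    intro n
    obtain ⟨k, hk⟩ := IsImage.exists_prefix hβ hl (n + 1)
    have hmem : β n ∈ (factorAt α 0 k).flatMap h := by
      refine hk.subset ?_
      rw [factorAt_add, factorAt_one]; simp
    obtain ⟨c, hc, hm⟩ := List.mem_flatMap.1 hmem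
    obtain ⟨s, -, rfl⟩ := mem_factorAt hc
    exact hS _ _ hm
  have hWβ : OccursAt W β 0 := by
    rw [hW, ← hα n]
    exact hβ _
  have get : ∀ s, s < W.length → W[s]? = some (β s) := fun s hs => by
    rw [List.getElem?_eq_getElem hs, hWβ.getElem hs, zero_add]
  have get' : ∀ s, W[s]? = some b → β s = b := fun s hs => by
    rw [get s (List.getElem?_eq_some_iff.1 hs).1] at hs
    exact Option.some.inj hs
  rw [get _ hiq, get _ hjq] at hq
  exact fun hup => not_ultimatelyPeriodic_of_tails_ne hd hβS hβ' hne hb hki hij (get' k hbk)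
    (get' i hbi) (get' j hbj) (fun e => hq (congrArg some e)) (hup.image hβ hl)

lemma length_flatMap_le {g : A → List B} {G : ℕ} (hG : ∀ c, (g c).length ≤ G) (w : List A) :
    (w.flatMap g).length ≤ w.length * G := by
  induction w with
  | nil => simp
  | cons c w ih =>
    rw [List.flatMap_cons, List.length_append, List.length_cons, add_mul, one_mul, add_comm]
    exact add_le_add ih (hG c)

theorem exists_witness_of_not_ultimatelyPeriodic {D : Type} [Finite D] {φ : D → List D} {a : D}
    {α : ℕ → D} (hp : Prolongable φ a) (hα : IsFixedSeq φ a α) (hnup : ¬ UltimatelyPeriodic α) :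
    ∃ (m : ℕ) (h : D → List (Fin m)) (ψ : Fin m → List (Fin m)) (d n : ℕ) (b : Fin m)
      (t k i j q : ℕ), (∀ c, (φ c).flatMap h = (h c).flatMap ψ) ∧ (∀ c, ψ c ≠ []) ∧
      HasDelay ψ Set.univ d ∧ SelfReproducing ψ b t ∧ k < i ∧ i < j ∧
      ∃ W, W = ((wordMap φ)^[n] [a]).flatMap h ∧ W[k]? = some b ∧ W[i]? = some b ∧
        W[j]? = some b ∧ i + q < W.length ∧ j + q < W.length ∧ W[i + q]? ≠ W[j + q]? := by
  obtain ⟨m, h, g, ψ, l, comm, hg, hns⟩ := exists_reduction φ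
  have hI := hα.isImage hp
  have hgw : ∀ w : List D, (w.flatMap h).flatMap g = (wordMap φ)^[l] w := by
    intro w
    rw [List.flatMap_assoc, show (fun x => (h x).flatMap g) = fun x => (wordMap φ)^[l] [x] from
      funext hg, flatMap_iterate_wordMap]
  obtain ⟨G, hG⟩ : ∃ G, ∀ c, (g c).length ≤ G := by
    obtain ⟨G, hG⟩ := (Set.finite_range fun c => (g c).length).bddAbove
    exact ⟨G, fun c => hG ⟨c, rfl⟩⟩
  have hgrowth : ∀ K, ∃ n, K < (((wordMap φ)^[n] [a]).flatMap h).length := by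
    intro K
    obtain ⟨n, hn, hlen⟩ := hp.exists_length_ge (K * G + 1) l
    obtain ⟨n, rfl⟩ := Nat.exists_eq_add_of_le hn
    refine ⟨n, ?_⟩
    rw [Function.iterate_add_apply, ← hgw] at hlen
    have := length_flatMap_le hG (((wordMap φ)^[n] [a]).flatMap h)
    by_contra hcon
    have := Nat.mul_le_mul_right G (not_lt.1 hcon)
    omega
  have hl : ∀ K, ∃ n, K ≤ imageLength h α n := fun K => by
    obtain ⟨n, hn⟩ := hgrowth K
    exact ⟨_, hn.le.trans (hα.imageLength_length' n).ge⟩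
  obtain ⟨β, hβ, hβ'⟩ := exists_image_fixed hI (fun n => comm (α n)) hl
  have hWβ : ∀ n, OccursAt (((wordMap φ)^[n] [a]).flatMap h) β 0 := fun n => by
    rw [← hα n]
    exact hβ _
  have hgβ : IsImage g β α := by
    intro n
    obtain ⟨k, hk⟩ := IsImage.exists_prefix hβ hl n
    refine OccursAt.of_prefix ?_ (flatMap_prefix g hk)
    rw [hgw]
    have h0 : (imageLength φ α)^[l] 0 = 0 := Function.iterate_fixed (by simp [imageLength]) l
    have := (hI.iterate (occursAt_factorAt α 0 k) l).1
    rwa [h0] at this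
  have hglen : ∀ K, ∃ n, K ≤ imageLength g β n := by
    intro K
    obtain ⟨n, hn, hlen⟩ := hp.exists_length_ge K l
    obtain ⟨n, rfl⟩ := Nat.exists_eq_add_of_le hn
    refine ⟨(((wordMap φ)^[n] [a]).flatMap h).length, ?_⟩
    rwa [imageLength, hWβ n, hgw, ← Function.iterate_add_apply]
  have hβnup : ¬ UltimatelyPeriodic β := fun hup => hnup (hup.image hgβ hglen)
  have hgrow : ∃ q, imageLength ψ β q ≠ q := by
    by_contra! hcon
    have hconst : ∀ n, (((wordMap φ)^[n] [a]).flatMap h).length = (h a).length := by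
      intro n
      induction n with
      | zero => simp
      | succ n ih =>
        have := hcon (((wordMap φ)^[n] [a]).flatMap h).length
        rw [imageLength, hWβ n] at this
        rw [hα.flatMap_iterate (fun n => comm (α n)) n 1, ← ih, ← this]
        rfl
    obtain ⟨n, hn⟩ := hgrowth (h a).length
    rw [hconst] at hn
    exact lt_irrefl _ hn
  obtain hs | ⟨hne, d, hd⟩ := simplifiable_or_delay ψ
  · exact absurd hs hns
  obtain ⟨b, t, k, i, j, q, hb, hki, hij, hk, hi, hj, hq⟩ :=
    exists_tails_ne_of_not_ultimatelyPeriodic hne hβ' hgrow hβnup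
  obtain ⟨n, hn⟩ := hgrowth (j + q)
  have get : ∀ s, s ≤ j + q →
      (((wordMap φ)^[n] [a]).flatMap h)[s]? = some (β s) := fun s hs => by
    rw [List.getElem?_eq_getElem (by omega), (hWβ n).getElem (by omega), zero_add]
  refine ⟨m, h, ψ, d, n, b, t, k, i, j, q, comm, hne, ?_, hb, hki, hij, _, rfl, ?_, ?_, ?_,
    by omega, hn, ?_⟩
  · intro U V hU hV _ _ hhead
    obtain _ | ⟨x, u⟩ := U
    · simp at hU
    obtain _ | ⟨y, v⟩ := V
    · simp at hV
    simp only [List.length_cons, Nat.add_right_cancel_iff] at hU hV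
    exact hd x y u v (fun e => hhead (by simp [e])) hU.ge hV.ge
  · rw [get k (by omega), hk]
  · rw [get i (by omega), hi]
  · rw [get j (by omega), hj]
  · rw [get _ (by omega), get _ le_rfl]
    exact fun e => hq (Option.some.inj e)

end Reduction

section Encoding

/-- The image of the letter c under the morphism with image list l, fixing letters out of range. -/
def letterImage (l : List (List ℕ)) (c : ℕ) : List ℕ := (l[c]?).getD [c]

/-- Encoding of a morphism between finite alphabets as a list of lists of naturals. -/
def encodeLetters {m k : ℕ} (h : Fin m → List (Fin k)) : List (List ℕ) :=
  (List.finRange m).map fun i => (h i).map Fin.val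

lemma letterImage_mem {l : List (List ℕ)} {c : ℕ} (hc : c < l.length) : letterImage l c ∈ l := by
  simp [letterImage, hc]

lemma letterImage_ne_nil {l : List (List ℕ)} (hl : ∀ w ∈ l, w ≠ []) (c : ℕ) :
    letterImage l c ≠ [] := by
  by_cases hc : c < l.length
  · exact hl _ (letterImage_mem hc)
  · simp [letterImage, not_lt.1 hc]

variable {m k : ℕ}

@[simp] lemma length_encodeLetters (h : Fin m → List (Fin k)) : (encodeLetters h).length = m := by
  simp [encodeLetters]

@[simp] lemma letterImage_encodeLetters (h : Fin m → List (Fin k)) (c : Fin m) :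
    letterImage (encodeLetters h) c = (h c).map Fin.val := by
  simp [letterImage, encodeLetters]

lemma flatMap_letterImage (h : Fin m → List (Fin k)) (w : List (Fin m)) :
    (w.map Fin.val).flatMap (letterImage (encodeLetters h)) = (w.flatMap h).map Fin.val := by
  rw [List.flatMap_map, List.map_flatMap]
  simp

lemma iterate_letterImage (φ : Fin m → List (Fin m)) (n : ℕ) (w : List (Fin m)) :
    (wordMap (letterImage (encodeLetters φ)))^[n] (w.map Fin.val) =
      ((wordMap φ)^[n] w).map Fin.val :=
  ((Function.Semiconj.iterate_right (f := List.map Fin.val)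
    (fun w => (flatMap_letterImage φ w).symm) n) w).symm

lemma iterate_letterImage_singleton (φ : Fin m → List (Fin m)) (n : ℕ) (a : Fin m) :
    (wordMap (letterImage (encodeLetters φ)))^[n] [(a : ℕ)] =
      ((wordMap φ)^[n] [a]).map Fin.val :=
  iterate_letterImage φ n [a]

lemma Prolongable.letterImage {φ : Fin m → List (Fin m)} {a : Fin m} (hp : Prolongable φ a) :
    Prolongable (letterImage (encodeLetters φ)) (a : ℕ) := by
  obtain ⟨⟨w, hw, hwa⟩, ht⟩ := hp
  refine ⟨⟨w.map Fin.val, by simpa using hw, by simp [hwa]⟩, ?_⟩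
  simpa [iterate_letterImage_singleton] using ht

lemma IsFixedSeq.letterImage {φ : Fin m → List (Fin m)} {a : Fin m} {α : ℕ → Fin m}
    (hα : IsFixedSeq φ a α) :
    IsFixedSeq (letterImage (encodeLetters φ)) (a : ℕ) (Fin.val ∘ α) := by
  intro n
  rw [iterate_letterImage_singleton, List.length_map, factorAt_comp, hα n]

lemma ultimatelyPeriodic_comp_val {α : ℕ → Fin m} :
    UltimatelyPeriodic (Fin.val ∘ α) ↔ UltimatelyPeriodic α := by
  simp [UltimatelyPeriodic, Fin.val_inj]

lemma exists_map_val {w : List ℕ} (hw : ∀ c ∈ w, c < m) : ∃ v : List (Fin m), w = v.map Fin.val :=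
  ⟨w.pmap (fun c hc => ⟨c, hc⟩) hw, by simp [List.map_pmap]⟩

lemma comparable_map_val {u v : List (Fin m)} :
    Comparable (u.map Fin.val) (v.map Fin.val) ↔ Comparable u v := by
  simp [Comparable, List.prefix_map_iff_of_injective Fin.val_injective]

/-- All words of length d with letters in the list L. -/
def wordsOver (L : List ℕ) (d : ℕ) : List (List ℕ) :=
  (fun W => L.flatMap fun c => W.map (c :: ·))^[d] [[]]

lemma mem_wordsOver {L : List ℕ} {d : ℕ} {w : List ℕ} :
    w ∈ wordsOver L d ↔ w.length = d ∧ ∀ c ∈ w, c ∈ L := by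
  induction d generalizing w with
  | zero => simp +contextual [wordsOver, List.length_eq_zero_iff]
  | succ d ih =>
    have : wordsOver L (d + 1) = L.flatMap fun c => (wordsOver L d).map (c :: ·) := by
      simp only [wordsOver, Function.iterate_succ_apply']
    rw [this]
    cases w with
    | nil => simp
    | cons c w =>
      simp only [List.mem_flatMap, List.mem_map, ih, List.length_cons, List.forall_mem_cons]
      grind

/-- A finite certificate that the pure morphic word generated by φ from a is not ultimately
periodic: an image of the word under h is fixed by the nonerasing morphism ψ of bounded delay, and
contains a self-reproducing letter with two different continuations. -/
def NonperiodicityWitness (φ : List (List ℕ)) (a : ℕ) (h ψ : List (List ℕ))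
    (d n b t k i j q : ℕ) : Prop :=
  φ.map (fun w => w.flatMap (letterImage h)) = h.map (fun w => w.flatMap (letterImage ψ)) ∧
  (∀ w ∈ ψ, w ≠ []) ∧
  (∀ U ∈ wordsOver h.flatten (d + 1), ∀ V ∈ wordsOver h.flatten (d + 1), U.head? = V.head? ∨
    ¬ Comparable (U.flatMap (letterImage ψ)) (V.flatMap (letterImage ψ))) ∧
  SelfReproducing (letterImage ψ) b t ∧ k < i ∧ i < j ∧
  ((wordMap (letterImage φ))^[n] [a]).flatMap (letterImage h) ∈
    {W | W[k]? = some b ∧ W[i]? = some b ∧ W[j]? = some b ∧ i + q < W.length ∧ j + q < W.length ∧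
      W[i + q]? ≠ W[j + q]?}

lemma NonperiodicityWitness.not_ultimatelyPeriodic {φ : Fin m → List (Fin m)} {a : Fin m}
    {α : ℕ → Fin m} (hp : Prolongable φ a) (hα : IsFixedSeq φ a α) {h ψ : List (List ℕ)}
    {d n b t k i j q : ℕ}
    (H : NonperiodicityWitness (encodeLetters φ) a h ψ d n b t k i j q) :
    ¬ UltimatelyPeriodic α := by
  obtain ⟨hc, hne, hd, hb, hki, hij, h1, h2, h3, h4, h5, h6⟩ := H
  have hlen : h.length = m := by simpa using (congrArg List.length hc).symm
  rw [← ultimatelyPeriodic_comp_val]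
  refine not_ultimatelyPeriodic_of_image (S := {c | c ∈ h.flatten}) (d := d) hp.letterImage
    hα.letterImage (fun N => ?_) (letterImage_ne_nil hne) ?_ ?_ hb hki hij rfl h1 h2 h3 h4 h5 h6
  · have := congrArg (fun l => l[(α N : ℕ)]?) hc
    have hlt : (α N : ℕ) < h.length := by rw [hlen]; exact (α N).2
    simpa [letterImage, hlt] using this
  · intro U V hU hV hUS hVS hUV
    exact (hd U (mem_wordsOver.2 ⟨hU, hUS⟩) V (mem_wordsOver.2 ⟨hV, hVS⟩)).resolve_left hUV
  · intro N c hcN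
    exact List.mem_flatten.2 ⟨_, letterImage_mem (by rw [hlen]; exact (α N).2), hcN⟩

lemma exists_nonperiodicityWitness {φ : Fin m → List (Fin m)} {a : Fin m}
    {α : ℕ → Fin m} (hp : Prolongable φ a) (hα : IsFixedSeq φ a α) (hn : ¬ UltimatelyPeriodic α) :
    ∃ h ψ d n b t k i j q,
      NonperiodicityWitness (encodeLetters φ) a h ψ d n b t k i j q := by
  obtain ⟨M, h, ψ, d, n, b, t, k, i, j, q, comm, hne, hd, hb, hki, hij, W, hW, h1, h2, h3, h4, h5,
    h6⟩ := exists_witness_of_not_ultimatelyPeriodic hp hα hn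
  refine ⟨encodeLetters h, encodeLetters ψ, d, n, b, t, k, i, j, q, ?_, ?_, ?_, ?_, hki, hij, ?_⟩
  · rw [encodeLetters, encodeLetters, List.map_map, List.map_map]
    refine List.map_congr_left fun c _ => ?_
    simp only [Function.comp_apply, ← encodeLetters.eq_def]
    rw [flatMap_letterImage, flatMap_letterImage, comm]
  · simpa [encodeLetters] using hne
  · have hlift : ∀ U ∈ wordsOver (encodeLetters h).flatten (d + 1),
        ∃ U' : List (Fin M), U'.length = d + 1 ∧ U = U'.map Fin.val := by
      intro U hU
      obtain ⟨hl, hU⟩ := mem_wordsOver.1 hU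
      obtain ⟨U', rfl⟩ := exists_map_val (m := M) (w := U) fun c hc => by
        have := hU c hc
        simp only [encodeLetters, List.mem_flatten, List.mem_map] at this
        obtain ⟨_, ⟨i, -, rfl⟩, hc⟩ := this
        obtain ⟨y, -, rfl⟩ := List.mem_map.1 hc
        exact y.2
      exact ⟨U', by simpa using hl, rfl⟩
    intro U hU V hV
    obtain ⟨U, hUl, rfl⟩ := hlift U hU
    obtain ⟨V, hVl, rfl⟩ := hlift V hV
    rw [flatMap_letterImage, flatMap_letterImage, comparable_map_val, or_iff_not_imp_left]
    intro hne
    refine hd U V hUl hVl (by simp) (by simp) fun hUV => hne ?_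
    rw [List.head?_map, List.head?_map, hUV]
  · unfold SelfReproducing at hb ⊢
    simpa [iterate_letterImage_singleton, Fin.val_inj] using hb
  · rw [iterate_letterImage_singleton, flatMap_letterImage, ← hW]
    refine ⟨by simp [h1], by simp [h2], by simp [h3], by simpa using h4, by simpa using h5, ?_⟩
    rw [List.getElem?_map, List.getElem?_map]
    exact fun h => h6 (Option.map_injective Fin.val_injective h)

lemma PeriodicityWitness.letterImage {φ : Fin m → List (Fin m)} {a : Fin m}
    {u v₁ v₂ : List (Fin m)} {i j : ℕ} (H : PeriodicityWitness φ a u v₁ v₂ i j) :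
    PeriodicityWitness (letterImage (encodeLetters φ)) (a : ℕ) (u.map Fin.val) (v₁.map Fin.val)
      (v₂.map Fin.val) i j := by
  have hpow : ∀ (v : List (Fin m)) i, wordPow (v.map Fin.val) i = (wordPow v i).map Fin.val := by
    intro v i
    simp [wordPow, List.map_flatMap]
  obtain ⟨h1, h2, h3, h4⟩ := H
  refine ⟨by simp [h1], by simpa using h2, ?_, ?_⟩
  · rw [flatMap_letterImage, h3, ← List.map_append, hpow]
    simp
  · rw [← List.map_append, ← List.map_append, flatMap_letterImage, h4, hpow]

/-- A finite certificate that φ is not the encoding of a morphism prolongable on a. -/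
def NotProlongableWitness (φ : List (List ℕ)) (a n : ℕ) : Prop :=
  (∃ c ∈ a :: φ.flatten, φ.length ≤ c) ∨ (letterImage φ a).head? ≠ some a ∨
    (wordMap (letterImage φ))^[n + 1] [a] = (wordMap (letterImage φ))^[n] [a]

lemma Prolongable.iterate_succ_ne {φ : A → List A} {a : A} (hp : Prolongable φ a) (n : ℕ) :
    (wordMap φ)^[n + 1] [a] ≠ (wordMap φ)^[n] [a] := by
  intro h
  have hc : ∀ r, (wordMap φ)^[n + r] [a] = (wordMap φ)^[n] [a] := by
    intro r
    induction r with
    | zero => rfl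
    | succ r ih => rw [← add_assoc, Function.iterate_succ_apply', ih,
        ← Function.iterate_succ_apply' (wordMap φ), h]
  obtain ⟨N, hN, hl⟩ := hp.exists_length_ge (((wordMap φ)^[n] [a]).length + 1) n
  obtain ⟨r, rfl⟩ := Nat.exists_eq_add_of_le hN
  rw [hc] at hl
  omega

lemma not_notProlongableWitness {φ : Fin m → List (Fin m)} {a : Fin m} (hp : Prolongable φ a)
    (n : ℕ) : ¬ NotProlongableWitness (encodeLetters φ) a n := by
  rintro (⟨c, hc, hle⟩ | hh | hn)
  · rw [length_encodeLetters] at hle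
    rcases List.mem_cons.1 hc with rfl | hc
    · omega
    · simp only [encodeLetters, List.mem_flatten, List.mem_map] at hc
      obtain ⟨_, ⟨i, -, rfl⟩, hc⟩ := hc
      obtain ⟨y, -, rfl⟩ := List.mem_map.1 hc
      omega
  · obtain ⟨w, -, hw⟩ := hp.1
    simp [hw] at hh
  · exact hp.letterImage.iterate_succ_ne n hn

lemma exists_fixedSeq {φ : A → List A} {a : A} (hp : Prolongable φ a) : ∃ α, IsFixedSeq φ a α := by
  obtain ⟨w, -, hw⟩ := hp.1
  refine exists_limit (fun n => (wordMap φ)^[n] [a]) (fun m n hmn => ?_)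
    fun K => (hp.exists_length_ge K 0).imp fun n hn => hn.2
  induction n, hmn using Nat.le_induction with
  | base => exact List.prefix_rfl
  | succ n _ ih =>
    rw [iterate_succ_of_head hw]
    exact ih.trans (List.prefix_append _ _)

lemma exists_prolongable_of_not_witness {l : List (List ℕ)} {a : ℕ}
    (H : ∀ n, ¬ NotProlongableWitness l a n) :
    ∃ (m : ℕ) (φ : Fin m → List (Fin m)) (b : Fin m),
      l = encodeLetters φ ∧ a = b ∧ Prolongable φ b := by
  simp only [NotProlongableWitness, not_or, not_exists, not_and, not_le, not_not] at H
  have hlt := (H 0).1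
  obtain ⟨m, φ, rfl⟩ : ∃ (m : ℕ) (φ : Fin m → List (Fin m)), l = encodeLetters φ := by
    have hw : ∀ i : Fin l.length, ∃ v : List (Fin l.length), l[i] = v.map Fin.val := fun i =>
      exists_map_val fun c hc => hlt c
        (List.mem_cons_of_mem _ (List.mem_flatten.2 ⟨_, List.getElem_mem i.2, hc⟩))
    choose φ hφ using hw
    refine ⟨l.length, φ, List.ext_getElem (by simp) fun i hi _ => ?_⟩
    simpa [encodeLetters] using hφ ⟨i, hi⟩
  obtain ⟨b, rfl⟩ : ∃ b : Fin m, a = b :=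
    ⟨⟨a, by simpa using hlt a List.mem_cons_self⟩, rfl⟩
  refine ⟨m, φ, b, rfl, rfl, ?_⟩
  have hhead : ∃ w, φ b = b :: w := by
    have := (H 0).2.1
    rw [letterImage_encodeLetters, List.head?_map, Option.map_eq_some_iff] at this
    obtain ⟨c, hc, hcb⟩ := this
    obtain rfl := Fin.val_injective hcb
    exact List.head?_eq_some_iff.1 hc
  obtain ⟨w, hw⟩ := hhead
  have hne : ∀ n, (wordMap φ)^[n] w ≠ [] := by
    intro n h
    refine (H n).2.2 ?_
    rw [iterate_letterImage_singleton, iterate_letterImage_singleton, iterate_succ_of_head hw,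
      h, List.append_nil]
  refine ⟨⟨w, hne 0, hw⟩, StrictMono.tendsto_atTop (strictMono_nat_of_lt_succ fun n => ?_)⟩
  rw [iterate_succ_of_head hw, List.length_append]
  exact Nat.lt_add_of_pos_right (List.length_pos_iff.2 (hne n))

end Encoding

section Computability

variable {σ : Type*} [Primcodable σ]

lemma primrec_flatMap_letterImage {f : σ → List ℕ} {l : σ → List (List ℕ)} (hf : Primrec f)
    (hl : Primrec l) : Primrec fun x => (f x).flatMap (letterImage (l x)) :=
  Primrec.list_flatMap hf (Primrec.option_getD.comp
    (Primrec.list_getElem?.comp (hl.comp Primrec.fst) Primrec.snd)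
    (Primrec.list_cons.comp Primrec.snd (Primrec.const [])))

lemma primrec_iterate_letterImage {l : σ → List (List ℕ)} {n a : σ → ℕ} (hl : Primrec l)
    (hn : Primrec n) (ha : Primrec a) :
    Primrec fun x => (wordMap (letterImage (l x)))^[n x] [a x] :=
  Primrec.nat_iterate hn (Primrec.list_cons.comp ha (Primrec.const []))
    (primrec_flatMap_letterImage Primrec.snd (hl.comp Primrec.fst))

lemma primrec_wordsOver {L : σ → List ℕ} {d : σ → ℕ} (hL : Primrec L) (hd : Primrec d) :
    Primrec fun x => wordsOver (L x) (d x) :=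
  Primrec.nat_iterate hd (Primrec.const [[]])
    (Primrec.list_flatMap (hL.comp Primrec.fst) (Primrec.list_map
      (Primrec.snd.comp Primrec.fst)
      (Primrec.list_cons.comp (Primrec.snd.comp Primrec.fst) Primrec.snd)))

lemma primrec_wordPow {v : σ → List ℕ} {i : σ → ℕ} (hv : Primrec v) (hi : Primrec i) :
    Primrec fun x => wordPow (v x) (i x) :=
  Primrec.list_flatMap (Primrec.list_range.comp hi) (hv.comp Primrec.fst)

lemma primrecPred_comparable {u v : σ → List ℕ} (hu : Primrec u) (hv : Primrec v) :
    PrimrecPred fun x => Comparable (u x) (v x) :=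
  (Primrec.eq.comp (Primrec.list_take.comp (Primrec.list_length.comp hv) hu)
    (Primrec.list_take.comp (Primrec.list_length.comp hu) hv)).of_eq
    fun _ => comparable_iff_take.symm

lemma primrecPred_forall_mem {τ : Type*} [Primcodable τ] {L : σ → List τ} {p : τ → σ → Prop}
    (hL : Primrec L) (hp : PrimrecPred fun y : τ × σ => p y.1 y.2) :
    PrimrecPred fun x => ∀ c ∈ L x, p c x :=
  (PrimrecRel.forall_mem_list (R := p) hp).comp hL Primrec.id

lemma primrecPred_exists_mem {τ : Type*} [Primcodable τ] {L : σ → List τ} {p : τ → σ → Prop}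
    (hL : Primrec L) (hp : PrimrecPred fun y : τ × σ => p y.1 y.2) :
    PrimrecPred fun x => ∃ c ∈ L x, p c x :=
  (PrimrecRel.exists_mem_list (R := p) hp).comp hL Primrec.id

lemma primrecPred_periodicityWitness {l : σ → List (List ℕ)} {u v₁ v₂ : σ → List ℕ}
    {a i j : σ → ℕ} (hl : Primrec l) (ha : Primrec a) (hu : Primrec u) (hv₁ : Primrec v₁)
    (hv₂ : Primrec v₂) (hi : Primrec i) (hj : Primrec j) :
    PrimrecPred fun x =>
      PeriodicityWitness (letterImage (l x)) (a x) (u x) (v₁ x) (v₂ x) (i x) (j x) := by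
  have hv := Primrec.list_append.comp hv₁ hv₂
  refine PrimrecPred.and (Primrec.eq.comp (Primrec.list_head?.comp hu)
    (Primrec.option_some.comp ha)) ?_
  refine PrimrecPred.and (Primrec.eq.comp hv (Primrec.const [])).not ?_
  refine PrimrecPred.and (Primrec.eq.comp (primrec_flatMap_letterImage hu hl) ?_)
    (Primrec.eq.comp (primrec_flatMap_letterImage hv hl)
      (primrec_wordPow (Primrec.list_append.comp hv₂ hv₁) hj))
  exact Primrec.list_append.comp (Primrec.list_append.comp hu (primrec_wordPow hv hi)) hv₁

lemma primrecPred_notProlongableWitness {l : σ → List (List ℕ)} {a n : σ → ℕ} (hl : Primrec l)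
    (ha : Primrec a) (hn : Primrec n) :
    PrimrecPred fun x => NotProlongableWitness (l x) (a x) (n x) := by
  have hsing := Primrec.list_cons.comp ha (Primrec.const [])
  refine PrimrecPred.or (primrecPred_exists_mem
    (Primrec.list_cons.comp ha (Primrec.list_flatten.comp hl))
    (Primrec.nat_le.comp (Primrec.list_length.comp (hl.comp Primrec.snd)) Primrec.fst))
    (PrimrecPred.or (PrimrecPred.not ?_) ?_)
  · refine (Primrec.eq.comp (Primrec.list_head?.comp (primrec_flatMap_letterImage hsing hl))
      (Primrec.option_some.comp ha)).of_eq fun x => ?_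
    simp
  · exact Primrec.eq.comp (primrec_iterate_letterImage hl (Primrec.succ.comp hn) ha)
      (primrec_iterate_letterImage hl hn ha)

lemma primrecPred_selfReproducing {l : σ → List (List ℕ)} {b t : σ → ℕ} (hl : Primrec l)
    (hb : Primrec b) (ht : Primrec t) :
    PrimrecPred fun x => SelfReproducing (letterImage (l x)) (b x) (t x) := by
  have hW := primrec_iterate_letterImage hl ht hb
  refine PrimrecPred.and ?_ (Primrec.nat_le.comp (Primrec.const 2) (Primrec.list_length.comp hW))
  exact (primrecPred_exists_mem (p := fun c x => c = b x) hW
    (Primrec.eq.comp Primrec.fst (hb.comp Primrec.snd))).of_eq (by simp)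

lemma primrecPred_nonperiodicityWitness {φ h ψ : σ → List (List ℕ)}
    {a d n b t k i j q : σ → ℕ} (hφ : Primrec φ) (ha : Primrec a) (hh : Primrec h)
    (hψ : Primrec ψ) (hd : Primrec d) (hn : Primrec n) (hb : Primrec b) (ht : Primrec t)
    (hk : Primrec k) (hi : Primrec i) (hj : Primrec j) (hq : Primrec q) :
    PrimrecPred fun x => NonperiodicityWitness (φ x) (a x) (h x) (ψ x) (d x) (n x) (b x) (t x)
      (k x) (i x) (j x) (q x) := by
  have hwords := primrec_wordsOver (Primrec.list_flatten.comp hh) (Primrec.succ.comp hd)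
  have hW := primrec_flatMap_letterImage (primrec_iterate_letterImage hφ hn ha) hh
  have hlen := Primrec.list_length.comp hW
  have hiq := Primrec.nat_add.comp hi hq
  have hjq := Primrec.nat_add.comp hj hq
  have hb' := Primrec.option_some.comp hb
  refine PrimrecPred.and (Primrec.eq.comp
    (Primrec.list_map hφ (primrec_flatMap_letterImage Primrec.snd (hh.comp Primrec.fst)))
    (Primrec.list_map hh (primrec_flatMap_letterImage Primrec.snd (hψ.comp Primrec.fst)))) ?_
  refine PrimrecPred.and (primrecPred_forall_mem hψ
    (Primrec.eq.comp Primrec.fst (Primrec.const [])).not) ?_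
  refine PrimrecPred.and (primrecPred_forall_mem hwords (primrecPred_forall_mem
    (hwords.comp Primrec.snd) (PrimrecPred.or ?_ (PrimrecPred.not ?_)))) ?_
  · exact Primrec.eq.comp (Primrec.list_head?.comp (Primrec.fst.comp Primrec.snd))
      (Primrec.list_head?.comp Primrec.fst)
  · have hψ' := hψ.comp (Primrec.snd.comp (Primrec.snd (α := List ℕ) (β := List ℕ × σ)))
    exact primrecPred_comparable
      (primrec_flatMap_letterImage (Primrec.fst.comp Primrec.snd) hψ')
      (primrec_flatMap_letterImage Primrec.fst hψ')
  refine PrimrecPred.and (primrecPred_selfReproducing hψ hb ht) ?_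
  refine PrimrecPred.and (Primrec.nat_lt.comp hk hi) ?_
  refine PrimrecPred.and (Primrec.nat_lt.comp hi hj) ?_
  refine PrimrecPred.and (Primrec.eq.comp (Primrec.list_getElem?.comp hW hk) hb') ?_
  refine PrimrecPred.and (Primrec.eq.comp (Primrec.list_getElem?.comp hW hi) hb') ?_
  refine PrimrecPred.and (Primrec.eq.comp (Primrec.list_getElem?.comp hW hj) hb') ?_
  refine PrimrecPred.and (Primrec.nat_lt.comp hiq hlen) ?_
  refine PrimrecPred.and (Primrec.nat_lt.comp hjq hlen) ?_
  exact (Primrec.eq.comp (Primrec.list_getElem?.comp hW hiq)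
    (Primrec.list_getElem?.comp hW hjq)).not

/-- If each input has a certificate of type τ for P or for Q, then a computable function separates
the inputs on which only P, respectively only Q, is certified. -/
theorem exists_computable_separation {τ : Type*} [Primcodable τ] {P Q : σ → τ → Prop}
    (hP : PrimrecPred fun y : σ × τ => P y.1 y.2) (hQ : PrimrecPred fun y : σ × τ => Q y.1 y.2)
    (hPQ : ∀ x, ∃ c, P x c ∨ Q x c) :
    ∃ f : σ → Bool, Computable f ∧
      ∀ x, (f x = true → ∃ c, P x c) ∧ (f x = false → ∃ c, Q x c) := by
  classical
  let g : σ → ℕ → Option Bool := fun x n => (Encodable.decode (α := τ) n).bind fun c =>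
    if P x c then some true else if Q x c then some false else none
  have hg : Primrec₂ g := by
    refine Primrec.option_bind (Primrec.decode.comp Primrec.snd) ?_
    have hpair : Primrec fun y : (σ × ℕ) × τ => (y.1.1, y.2) :=
      Primrec.pair (Primrec.fst.comp Primrec.fst) Primrec.snd
    exact Primrec.ite (hP.comp hpair) (Primrec.const _)
      (Primrec.ite (hQ.comp hpair) (Primrec.const _) (Primrec.const _))
  have hdom : ∀ x, (Nat.rfindOpt (g x)).Dom := by
    intro x
    obtain ⟨c, hc⟩ := hPQ x
    refine Nat.rfindOpt_dom.2 ⟨Encodable.encode c, ?_⟩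
    simp only [g, Encodable.encodek, Option.bind_some]
    by_cases h : P x c
    · exact ⟨true, by simp [h]⟩
    · exact ⟨false, by simp [h, hc.resolve_left h]⟩
  refine ⟨fun x => (Nat.rfindOpt (g x)).get (hdom x), ?_, fun x => ?_⟩
  · exact (Partrec.rfindOpt hg.to_comp).of_eq fun x => (Part.some_get (hdom x)).symm
  · obtain ⟨n, hn⟩ := Nat.rfindOpt_spec (Part.get_mem (hdom x))
    obtain ⟨c, -, hc⟩ := Option.bind_eq_some_iff.1 hn
    split_ifs at hc with h1 h2
    · have := Option.some.inj hc
      exact ⟨fun _ => ⟨c, h1⟩, fun h => by simp [← this] at h⟩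
    · have := Option.some.inj hc
      exact ⟨fun h => by simp [← this] at h, fun _ => ⟨c, h2⟩⟩

end Computability

/-- Pansiot, Harju–Linna: eventual periodicity of pure morphic sequences is decidable. -/
theorem ultimately_periodic_decidable :
    ∃ f : List (List ℕ) × ℕ → Bool, Computable f ∧
      ∀ (m : ℕ) (φ : Fin m → List (Fin m)) (a : Fin m) (α : ℕ → Fin m),
        Prolongable φ a → IsFixedSeq φ a α →
        (f (encodeMorphism φ, (a : ℕ)) = true ↔ UltimatelyPeriodic α) := by
  let P : List (List ℕ) × ℕ → List (List ℕ) × List (List ℕ) × List ℕ → Prop := fun x c =>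
    PeriodicityWitness (letterImage x.1) x.2 (c.1.getD 0 []) (c.1.getD 1 []) (c.1.getD 2 [])
      (c.2.2.getD 0 0) (c.2.2.getD 1 0)
  let Q : List (List ℕ) × ℕ → List (List ℕ) × List (List ℕ) × List ℕ → Prop := fun x c =>
    NotProlongableWitness x.1 x.2 (c.2.2.getD 0 0) ∨
      NonperiodicityWitness x.1 x.2 c.1 c.2.1 (c.2.2.getD 0 0) (c.2.2.getD 1 0) (c.2.2.getD 2 0)
        (c.2.2.getD 3 0) (c.2.2.getD 4 0) (c.2.2.getD 5 0) (c.2.2.getD 6 0) (c.2.2.getD 7 0)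
  have hl : Primrec fun y : (List (List ℕ) × ℕ) × List (List ℕ) × List (List ℕ) × List ℕ => y.1.1 :=
    Primrec.fst.comp Primrec.fst
  have ha : Primrec fun y : (List (List ℕ) × ℕ) × List (List ℕ) × List (List ℕ) × List ℕ => y.1.2 :=
    Primrec.snd.comp Primrec.fst
  have hh : Primrec fun y : (List (List ℕ) × ℕ) × List (List ℕ) × List (List ℕ) × List ℕ => y.2.1 :=
    Primrec.fst.comp Primrec.snd
  have hψ : Primrec fun y : (List (List ℕ) × ℕ) × List (List ℕ) × List (List ℕ) × List ℕ =>
      y.2.2.1 := Primrec.fst.comp (Primrec.snd.comp Primrec.snd)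
  have hword : ∀ r, Primrec fun y : (List (List ℕ) × ℕ) × List (List ℕ) × List (List ℕ) × List ℕ =>
      y.2.1.getD r [] := fun r => (Primrec.list_getD []).comp hh (Primrec.const r)
  have hnum : ∀ r, Primrec fun y : (List (List ℕ) × ℕ) × List (List ℕ) × List (List ℕ) × List ℕ =>
      y.2.2.2.getD r 0 := fun r =>
    (Primrec.list_getD 0).comp (Primrec.snd.comp (Primrec.snd.comp Primrec.snd)) (Primrec.const r)
  obtain ⟨f, hf, hfPQ⟩ := exists_computable_separation (P := P) (Q := Q)
    (primrecPred_periodicityWitness hl ha (hword 0) (hword 1) (hword 2) (hnum 0) (hnum 1))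
    ((primrecPred_notProlongableWitness hl ha (hnum 0)).or
      (primrecPred_nonperiodicityWitness hl ha hh hψ (hnum 0) (hnum 1) (hnum 2) (hnum 3) (hnum 4)
        (hnum 5) (hnum 6) (hnum 7))) (by
      rintro ⟨l, a⟩
      by_cases hw : ∃ n, NotProlongableWitness l a n
      · obtain ⟨n, hn⟩ := hw
        exact ⟨([], [], [n]), Or.inr (Or.inl hn)⟩
      obtain ⟨m, φ, a, rfl, rfl, hp⟩ := exists_prolongable_of_not_witness (not_exists.1 hw)
      obtain ⟨α, hα⟩ := exists_fixedSeq hp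
      by_cases hup : UltimatelyPeriodic α
      · obtain ⟨u, v₁, v₂, i, j, H⟩ := hup.exists_witness hp hα
        exact ⟨([u.map Fin.val, v₁.map Fin.val, v₂.map Fin.val], [], [i, j]),
          Or.inl H.letterImage⟩
      · obtain ⟨h, ψ, d, n, b, t, k, i, j, q, H⟩ := exists_nonperiodicityWitness hp hα hup
        exact ⟨(h, ψ, [d, n, b, t, k, i, j, q]), Or.inr (Or.inr H)⟩)
  refine ⟨f, hf, fun m φ a α hp hα => ⟨fun h => ?_, fun h => ?_⟩⟩
  · obtain ⟨c, hc⟩ := (hfPQ _).1 h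
    exact ultimatelyPeriodic_comp_val.1
      (PeriodicityWitness.ultimatelyPeriodic hc hp.letterImage hα.letterImage)
  · by_contra hne
    obtain ⟨c, hc | hc⟩ := (hfPQ _).2 (Bool.eq_false_iff.2 hne)
    · exact not_notProlongableWitness hp _ hc
    · exact NonperiodicityWitness.not_ultimatelyPeriodic hp hα hc h
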